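/- arXiv:2206.03345 — 6 statements merged into one kernel-verified Lean document; each statement's English description precedes it below -/
import Mathlib

section
/- Let φ: ℝ^{n×n} → ℝ be twice differentiable and convex, let f(X) = φ(XXᵀ) for X ∈ ℝ^{n×r}, and let X⋆ ∈ ℝ^{n×r} be a global minimizer of f. Suppose X ∈ ℝ^{n×r} satisfies λ_min(XᵀX) ≤ ε_λ, ⟨∇f(X), V⟩ ≤ ε_g·‖V‖_F for all V ∈ ℝ^{n×r}, and ⟨∇²f(X)[V], V⟩ ≥ −ε_H·‖V‖_F² for all V ∈ ℝ^{n×r}, where ε_g, ε_H, ε_λ ≥ 0. Then f(X) − f(X⋆) ≤ C_g·ε_g + C_H·ε_H + C_λ·ε_λ, where C_g = ‖X‖_F/2, C_H = ‖X⋆‖_F²/2, and C_λ = 2·‖∇²φ(XXᵀ)‖_op·‖X⋆‖_F², with ‖∇²φ(XXᵀ)‖_op = sup{‖∇²φ(XXᵀ)[E]‖_F : ‖E‖_F = 1}. -/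
open Matrix

noncomputable section

/-- Frobenius norm of a real matrix. -/
def frobNorm {m r : Type*} [Fintype m] [Fintype r] (A : Matrix m r ℝ) : ℝ :=
  Real.sqrt (∑ i, ∑ j, (A i j) ^ 2)

/-- Trace inner product `⟨A,B⟩ = tr(AᵀB)` of real matrices. -/
def minner {m r : Type*} [Fintype m] [Fintype r] (A B : Matrix m r ℝ) : ℝ :=
  ∑ i, ∑ j, A i j * B i j

/-- Smallest eigenvalue of a symmetric real matrix, via the Rayleigh quotient
characterization `λ_min(A) = inf {vᵀAv : ‖v‖ = 1}`. -/
def lamMin {m : ℕ} (A : Matrix (Fin m) (Fin m) ℝ) : ℝ :=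
  sInf {c | ∃ v : Fin m → ℝ, (∑ i, (v i) ^ 2) = 1 ∧ c = ∑ i, A.mulVec v i * v i}

/-- Largest eigenvalue of a symmetric real matrix, via the Rayleigh quotient
characterization `λ_max(A) = sup {vᵀAv : ‖v‖ = 1}`. -/
def lamMax {m : ℕ} (A : Matrix (Fin m) (Fin m) ℝ) : ℝ :=
  sSup {c | ∃ v : Fin m → ℝ, (∑ i, (v i) ^ 2) = 1 ∧ c = ∑ i, A.mulVec v i * v i}

/-- `gradφ` is the gradient of `φ` with respect to the trace inner product. -/
def IsGradientOf {n : ℕ} (φ : Matrix (Fin n) (Fin n) ℝ → ℝ)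
    (gradφ : Matrix (Fin n) (Fin n) ℝ → Matrix (Fin n) (Fin n) ℝ) : Prop :=
  ∀ M E : Matrix (Fin n) (Fin n) ℝ,
    HasDerivAt (fun t : ℝ => φ (M + t • E)) (minner (gradφ M) E) 0

/-- `hessφ M E = ∇²φ(M)[E]` is the Hessian of `φ` applied to the direction `E`. -/
def IsHessianOf {n : ℕ}
    (gradφ : Matrix (Fin n) (Fin n) ℝ → Matrix (Fin n) (Fin n) ℝ)
    (hessφ : Matrix (Fin n) (Fin n) ℝ → Matrix (Fin n) (Fin n) ℝ → Matrix (Fin n) (Fin n) ℝ) :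
    Prop :=
  ∀ M E F : Matrix (Fin n) (Fin n) ℝ,
    HasDerivAt (fun t : ℝ => minner (gradφ (M + t • E)) F) (minner (hessφ M E) F) 0

/-- `φ` is `L`-gradient Lipschitz: `‖∇φ(M+E) − ∇φ(M)‖_F ≤ L‖E‖_F` for all `M, E`. -/
def GradLipschitz {n : ℕ} (gradφ : Matrix (Fin n) (Fin n) ℝ → Matrix (Fin n) (Fin n) ℝ)
    (L : ℝ) : Prop :=
  ∀ M E : Matrix (Fin n) (Fin n) ℝ, frobNorm (gradφ (M + E) - gradφ M) ≤ L * frobNorm E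

/-- `φ` is `(μ, r)`-restricted strongly convex:
`⟨∇²φ(M)[E], E⟩ ≥ μ‖E‖_F²` for all `M, E` of rank at most `r`. -/
def RestrictedStronglyConvex {n : ℕ}
    (hessφ : Matrix (Fin n) (Fin n) ℝ → Matrix (Fin n) (Fin n) ℝ → Matrix (Fin n) (Fin n) ℝ)
    (μ : ℝ) (r : ℕ) : Prop :=
  ∀ M E : Matrix (Fin n) (Fin n) ℝ, M.rank ≤ r → E.rank ≤ r →
    μ * (frobNorm E) ^ 2 ≤ minner (hessφ M E) E


section helpers

variable {m k : Type*} [Fintype m] [Fintype k]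

lemma minner_add_left (A B C : Matrix m k ℝ) : minner (A + B) C = minner A C + minner B C := by
  simp [minner, add_mul, Finset.sum_add_distrib]

lemma minner_comm (A B : Matrix m k ℝ) : minner A B = minner B A := by
  simp [minner, mul_comm]

lemma minner_add_right (A B C : Matrix m k ℝ) : minner C (A + B) = minner C A + minner C B := by
  simp [minner, mul_add, Finset.sum_add_distrib]

lemma minner_smul_left (c : ℝ) (A B : Matrix m k ℝ) : minner (c • A) B = c * minner A B := by
  simp [minner, Finset.mul_sum, mul_assoc]

lemma minner_smul_right (c : ℝ) (A B : Matrix m k ℝ) : minner A (c • B) = c * minner A B := by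
  rw [minner_comm, minner_smul_left, minner_comm]

lemma minner_neg_right (A B : Matrix m k ℝ) : minner A (-B) = - minner A B := by
  simp [minner]

lemma minner_sub_right (A B C : Matrix m k ℝ) : minner C (A - B) = minner C A - minner C B := by
  simp [minner, mul_sub, Finset.sum_sub_distrib]

lemma minner_sub_left (A B C : Matrix m k ℝ) : minner (A - B) C = minner A C - minner B C := by
  simp [minner, sub_mul, Finset.sum_sub_distrib]

lemma frobNorm_nonneg (A : Matrix m k ℝ) : 0 ≤ frobNorm A := Real.sqrt_nonneg _

lemma frobNorm_sq (A : Matrix m k ℝ) : frobNorm A ^ 2 = minner A A := by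
  rw [frobNorm, Real.sq_sqrt (by positivity)]
  simp [minner, sq]

lemma frobNorm_sq' (A : Matrix m k ℝ) : frobNorm A ^ 2 = ∑ i, ∑ j, A i j ^ 2 := by
  rw [frobNorm, Real.sq_sqrt (by positivity)]

lemma minner_self_nonneg (A : Matrix m k ℝ) : 0 ≤ minner A A := by
  rw [← frobNorm_sq]; positivity

lemma minner_le (A B : Matrix m k ℝ) : minner A B ≤ frobNorm A * frobNorm B := by
  have h := Finset.sum_mul_sq_le_sq_mul_sq (Finset.univ : Finset (m × k))
    (fun p => A p.1 p.2) (fun p => B p.1 p.2)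
  simp only [Fintype.sum_prod_type] at h
  rw [← frobNorm_sq', ← frobNorm_sq', ← mul_pow] at h
  exact (le_abs_self _).trans (abs_le_of_sq_le_sq h
    (mul_nonneg (frobNorm_nonneg _) (frobNorm_nonneg _)))

lemma frobNorm_smul (c : ℝ) (A : Matrix m k ℝ) : frobNorm (c • A) = |c| * frobNorm A := by
  rw [← abs_of_nonneg (frobNorm_nonneg (c • A)), ← abs_of_nonneg (frobNorm_nonneg A), ← abs_mul,
    ← sq_eq_sq_iff_abs_eq_abs, mul_pow, frobNorm_sq, frobNorm_sq, minner_smul_left,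
    minner_smul_right]
  ring

lemma minner_mul_left {l : Type*} [Fintype l] (A : Matrix m l ℝ) (B : Matrix l k ℝ)
    (C : Matrix m k ℝ) : minner (A * B) C = minner A (C * Bᵀ) := by
  simp only [minner, Matrix.mul_apply, Matrix.transpose_apply, Finset.sum_mul, Finset.mul_sum]
  refine Finset.sum_congr rfl fun i _ => ?_
  rw [Finset.sum_comm]
  refine Finset.sum_congr rfl fun i _ => Finset.sum_congr rfl fun j _ => by ring

lemma minner_transpose (A B : Matrix m k ℝ) : minner Aᵀ Bᵀ = minner A B := by
  simp only [minner, Matrix.transpose_apply]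
  exact Finset.sum_comm

lemma frob_sym_bound (F : Matrix m m ℝ) {s : ℝ} (hs : 0 < s) :
    frobNorm (Fᵀ + F + s • F) ≤ (2 + s) * frobNorm F := by
  have h0 := frobNorm_nonneg F
  refine abs_le_of_sq_le_sq' ?_ (by positivity) |>.2
  have h1 : minner Fᵀ Fᵀ = minner F F := minner_transpose F F
  have h2 : minner Fᵀ F ≤ minner F F := by
    have h := minner_self_nonneg (Fᵀ - F)
    simp only [minner_sub_left, minner_sub_right] at h
    rw [minner_comm F Fᵀ] at h
    linarith
  rw [mul_pow, frobNorm_sq, frobNorm_sq]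
  simp only [minner_add_left, minner_add_right, minner_smul_left, minner_smul_right]
  rw [minner_comm F Fᵀ, h1]
  nlinarith

end helpers

section calculus

open Filter Topology

variable {n : ℕ} {φ : Matrix (Fin n) (Fin n) ℝ → ℝ}
    {gradφ : Matrix (Fin n) (Fin n) ℝ → Matrix (Fin n) (Fin n) ℝ}
    {hessφ : Matrix (Fin n) (Fin n) ℝ → Matrix (Fin n) (Fin n) ℝ → Matrix (Fin n) (Fin n) ℝ}

lemma convex_continuous (hconv : ConvexOn ℝ Set.univ φ) : Continuous φ := by
  let _ : NormedAddCommGroup (Matrix (Fin n) (Fin n) ℝ) := Matrix.normedAddCommGroup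
  let _ : NormedSpace ℝ (Matrix (Fin n) (Fin n) ℝ) := Matrix.normedSpace
  exact hconv.locallyLipschitz.continuous

lemma grad_ineq (hconv : ConvexOn ℝ Set.univ φ) (hgrad : IsGradientOf φ gradφ)
    (M D : Matrix (Fin n) (Fin n) ℝ) : minner (gradφ M) D ≤ φ (M + D) - φ M := by
  have hc : ConvexOn ℝ Set.univ (fun t : ℝ => φ (M + t • D)) := by
    refine ⟨convex_univ, fun x _ y _ a b ha hb hab => ?_⟩
    have h := hconv.2 (Set.mem_univ (M + x • D)) (Set.mem_univ (M + y • D)) ha hb hab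
    have e : M + (a • x + b • y) • D = a • (M + x • D) + b • (M + y • D) := by
      have : M = a • M + b • M := by rw [← add_smul, hab, one_smul]
      rw [smul_add, smul_add, add_smul, smul_assoc, smul_assoc]
      nth_rewrite 1 [this]
      abel
    simpa only [e] using h
  have h := hc.le_slope_of_hasDerivWithinAt (Set.mem_univ (0 : ℝ)) (Set.mem_univ 1) one_pos
    (hgrad M D).hasDerivWithinAt
  simpa [slope_def_field] using h

lemma grad_mono (hconv : ConvexOn ℝ Set.univ φ) (hgrad : IsGradientOf φ gradφ)
    (M N : Matrix (Fin n) (Fin n) ℝ) : 0 ≤ minner (gradφ M - gradφ N) (M - N) := by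
  have h1 := grad_ineq hconv hgrad N (M - N)
  have h2 := grad_ineq hconv hgrad M (-(M - N))
  rw [minner_neg_right] at h2
  rw [minner_sub_left]
  have e1 : N + (M - N) = M := by abel
  have e2 : M + -(M - N) = N := by abel
  rw [e1] at h1
  rw [e2] at h2
  linarith

lemma grad_usc (hconv : ConvexOn ℝ Set.univ φ) (hgrad : IsGradientOf φ gradφ)
    (M W : Matrix (Fin n) (Fin n) ℝ) {c : ℝ} (hc : minner (gradφ M) W < c) :
    ∀ᶠ N in 𝓝 M, minner (gradφ N) W < c := by
  have h1 := (hgrad M W).tendsto_slope_zero_right.eventually_lt_const hc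
  obtain ⟨s, hs, hs0⟩ := (h1.and self_mem_nhdsWithin).exists
  have hs0 : 0 < s := hs0
  have hφ := convex_continuous hconv
  have hcont : Continuous (fun N => s⁻¹ * (φ (N + s • W) - φ N)) := by fun_prop
  have hs' : s⁻¹ * (φ (M + s • W) - φ M) < c := by simpa using hs
  filter_upwards [hcont.continuousAt.eventually_lt_const hs'] with N hN
  refine lt_of_le_of_lt ?_ hN
  have h := grad_ineq hconv hgrad N (s • W)
  rw [minner_smul_right] at h
  rw [inv_mul_eq_div, le_div_iff₀ hs0]
  linarith

lemma grad_tendsto (hconv : ConvexOn ℝ Set.univ φ) (hgrad : IsGradientOf φ gradφ)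
    (M W : Matrix (Fin n) (Fin n) ℝ) :
    Tendsto (fun N => minner (gradφ N) W) (𝓝 M) (𝓝 (minner (gradφ M) W)) := by
  refine tendsto_order.2 ⟨fun c hc => ?_, fun c hc => grad_usc hconv hgrad M W hc⟩
  have := grad_usc hconv hgrad M (-W) (c := -c) (by rw [minner_neg_right]; linarith)
  filter_upwards [this] with N hN
  rw [minner_neg_right] at hN
  linarith

lemma hess_slope (hhessφ : IsHessianOf gradφ hessφ) (M E F : Matrix (Fin n) (Fin n) ℝ) :
    Tendsto (fun t : ℝ => t⁻¹ * (minner (gradφ (M + t • E)) F - minner (gradφ M) F))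
      (𝓝[>] 0) (𝓝 (minner (hessφ M E) F)) := by
  simpa using (hhessφ M E F).tendsto_slope_zero_right

lemma hess_mono (hconv : ConvexOn ℝ Set.univ φ) (hgrad : IsGradientOf φ gradφ)
    (hhessφ : IsHessianOf gradφ hessφ) (M E Z : Matrix (Fin n) (Fin n) ℝ) :
    0 ≤ minner (hessφ M E - hessφ M Z) (E - Z) := by
  rw [minner_sub_left]
  refine ge_of_tendsto ((hess_slope hhessφ M E (E - Z)).sub (hess_slope hhessφ M Z (E - Z))) ?_
  filter_upwards [self_mem_nhdsWithin] with t ht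
  have ht : 0 < t := ht
  have h := grad_mono hconv hgrad (M + t • E) (M + t • Z)
  have e : M + t • E - (M + t • Z) = t • (E - Z) := by rw [smul_sub]; abel
  rw [e, minner_smul_right, minner_sub_left] at h
  have h' := nonneg_of_mul_nonneg_right h ht
  have := mul_nonneg (inv_pos.2 ht).le h'
  linarith

lemma eq_of_minner (A B : Matrix (Fin n) (Fin n) ℝ) (h : ∀ F, minner A F = minner B F) :
    A = B := by
  have h1 := h (A - B)
  rw [← sub_eq_zero, ← minner_sub_left, ← frobNorm_sq, frobNorm_sq'] at h1
  ext i j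
  rw [Finset.sum_eq_zero_iff_of_nonneg (fun i _ => by positivity)] at h1
  have h2 := h1 i (Finset.mem_univ _)
  rw [Finset.sum_eq_zero_iff_of_nonneg (fun i _ => by positivity)] at h2
  have h3 := h2 j (Finset.mem_univ _)
  have := pow_eq_zero_iff (two_ne_zero) |>.1 h3
  simpa [sub_eq_zero] using this

lemma hess_smul (hhessφ : IsHessianOf gradφ hessφ) (M E : Matrix (Fin n) (Fin n) ℝ) (c : ℝ) :
    hessφ M (c • E) = c • hessφ M E := by
  refine eq_of_minner _ _ fun F => ?_
  have h1 := hhessφ M (c • E) F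
  have h2 : HasDerivAt (fun t : ℝ => t * c) c 0 := by simpa using (hasDerivAt_id (0:ℝ)).mul_const c
  have h3 : HasDerivAt (fun t : ℝ => minner (gradφ (M + t • E)) F) (minner (hessφ M E) F)
      (0 * c) := by simpa using hhessφ M E F
  have h4 := h3.comp (0:ℝ) h2
  have h5 := h1.unique (by simpa [Function.comp_def, mul_smul] using h4)
  rw [h5, minner_smul_left, mul_comm]

lemma hess_bdd (hconv : ConvexOn ℝ Set.univ φ) (hgrad : IsGradientOf φ gradφ)
    (hhessφ : IsHessianOf gradφ hessφ) (M : Matrix (Fin n) (Fin n) ℝ) :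
    BddAbove ((fun E : Matrix (Fin n) (Fin n) ℝ => frobNorm (hessφ M E)) ''
      {E | frobNorm E = 1}) := by
  classical
  set N : ℝ := ((Fintype.card (Fin n × Fin n) : ℕ) : ℝ) with hN
  have hN0 : 0 ≤ N := by positivity
  -- test matrices
  let Z : Fin n × Fin n → Matrix (Fin n) (Fin n) ℝ := fun p => (N + 1) • Matrix.single p.1 p.2 (1:ℝ)
  let Q : Matrix (Fin n) (Fin n) ℝ → ℝ := fun Y => minner (hessφ M Y) Y + frobNorm (hessφ M Y)
  obtain ⟨K, hK⟩ : ∃ K, ∀ p, Q (Z p) ≤ K ∧ Q (-(Z p)) ≤ K := by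
    refine ⟨∑ p, (|Q (Z p)| + |Q (-(Z p))|), fun p => ?_⟩
    have := Finset.single_le_sum (f := fun p => |Q (Z p)| + |Q (-(Z p))|)
      (fun i _ => by positivity) (Finset.mem_univ p)
    have h1 := le_abs_self (Q (Z p))
    have h2 := le_abs_self (Q (-(Z p)))
    have h3 := abs_nonneg (Q (Z p))
    have h4 := abs_nonneg (Q (-(Z p)))
    constructor <;> linarith
  refine ⟨N * K, ?_⟩
  rintro _ ⟨E, hE, rfl⟩
  have hE : frobNorm E = 1 := hE
  have key : ∀ Y, minner (hessφ M E) Y ≤ minner (hessφ M E) E + Q Y := by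
    intro Y
    have h := hess_mono hconv hgrad hhessφ M E Y
    rw [minner_sub_left, minner_sub_right, minner_sub_right] at h
    have h1 := minner_le (-(hessφ M Y)) E
    have h2 : frobNorm (-(hessφ M Y)) = frobNorm (hessφ M Y) := by simp [frobNorm]
    rw [h2, hE, minner_comm, minner_neg_right, minner_comm] at h1
    simp only [Q]
    linarith
  set H := hessφ M E with hH
  have hZ : ∀ p, minner H (Z p) = (N + 1) * H p.1 p.2 := by
    intro p
    simp only [Z, minner_smul_right]
    congr 1
    rw [minner, Finset.sum_eq_single p.1, Finset.sum_eq_single p.2]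
    · simp
    · intro b _ hb; simp [Matrix.single, hb.symm]
    · simp
    · intro b _ hb; simp [Matrix.single, hb.symm]
    · simp
  have habs : ∀ p : Fin n × Fin n, (N + 1) * |H p.1 p.2| ≤ minner H E + K := by
    intro p
    have h1 := key (Z p)
    have h2 := key (-(Z p))
    rw [minner_neg_right, hZ] at h2
    rw [hZ] at h1
    have := hK p
    rw [← abs_of_nonneg (by linarith : 0 ≤ N + 1), ← abs_mul]
    exact abs_le.2 ⟨by linarith, by linarith⟩
  set S : ℝ := ∑ p : Fin n × Fin n, |H p.1 p.2| with hS
  have hE1 : ∀ i j, |E i j| ≤ 1 := by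
    intro i j
    have h := frobNorm_sq' E
    rw [hE] at h
    have h1 := Finset.single_le_sum (f := fun i => ∑ j, E i j ^ 2)
      (fun i _ => by positivity) (Finset.mem_univ i)
    have h2 := Finset.single_le_sum (f := fun j => E i j ^ 2)
      (fun i _ => by positivity) (Finset.mem_univ j)
    rw [← sq_le_one_iff_abs_le_one]
    linarith
  have hHE : minner H E ≤ S := by
    rw [hS, Fintype.sum_prod_type, minner]
    refine Finset.sum_le_sum fun i _ => Finset.sum_le_sum fun j _ => ?_
    refine (le_abs_self _).trans ?_
    rw [abs_mul]
    exact mul_le_of_le_one_right (abs_nonneg _) (hE1 i j)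
  have hsum : (N + 1) * S ≤ N * (S + K) := by
    nth_rewrite 1 [hS]
    rw [Finset.mul_sum]
    refine (Finset.sum_le_sum (fun p _ => (habs p).trans (add_le_add_left hHE K))).trans ?_
    simp [hN, mul_add]
  have hS0 : 0 ≤ S := by positivity
  refine le_trans ?_ (show S ≤ N * K by linarith)
  refine abs_le_of_sq_le_sq' ?_ hS0 |>.2
  rw [frobNorm_sq', ← Fintype.sum_prod_type (f := fun p : Fin n × Fin n => H p.1 p.2 ^ 2)]
  have := Finset.sum_sq_le_sq_sum_of_nonneg (s := (Finset.univ : Finset (Fin n × Fin n)))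
    (f := fun p => |H p.1 p.2|) (fun i _ => abs_nonneg _)
  simpa using this

lemma hess_le (hconv : ConvexOn ℝ Set.univ φ) (hgrad : IsGradientOf φ gradφ)
    (hhessφ : IsHessianOf gradφ hessφ) (M E : Matrix (Fin n) (Fin n) ℝ) :
    frobNorm (hessφ M E) ≤ sSup ((fun E : Matrix (Fin n) (Fin n) ℝ =>
            frobNorm (hessφ M E)) '' {E | frobNorm E = 1}) * frobNorm E := by
  rcases eq_or_lt_of_le (frobNorm_nonneg E) with h | h
  · have h0 : E = 0 := by
      refine eq_of_minner _ _ fun F => ?_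
      have h1 := minner_le E F
      have h2 := minner_le E (-F)
      rw [← h, zero_mul] at h1 h2
      rw [minner_neg_right] at h2
      have : minner (0 : Matrix (Fin n) (Fin n) ℝ) F = 0 := by simp [minner]
      linarith
    have h1 := hess_smul hhessφ M E 0
    rw [zero_smul, zero_smul] at h1
    rw [← h, h0, h1]
    simp [frobNorm]
  · have h1 : frobNorm ((frobNorm E)⁻¹ • E) = 1 := by
      rw [frobNorm_smul, abs_of_pos (inv_pos.2 h), inv_mul_cancel₀ h.ne']
    have h2 := le_csSup (hess_bdd hconv hgrad hhessφ M) ⟨_, h1, rfl⟩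
    simp only [hess_smul hhessφ, frobNorm_smul, abs_of_pos (inv_pos.2 h)] at h2
    rwa [inv_mul_eq_div, div_le_iff₀ h] at h2

lemma hessf_bound (hconv : ConvexOn ℝ Set.univ φ) (hgrad : IsGradientOf φ gradφ)
    (hhessφ : IsHessianOf gradφ hessφ) {r : ℕ} (X V HV : Matrix (Fin n) (Fin r) ℝ)
    (hf : ∀ (i : Fin n) (j : Fin r),
      HasDerivAt
        (fun t : ℝ => ((2 : ℝ) • (gradφ ((X + t • V) * (X + t • V)ᵀ) * (X + t • V))) i j)
        (HV i j) 0) {s : ℝ} (hs : 0 < s) :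
    minner HV V ≤ 2 * minner (hessφ (X * Xᵀ) ((V * Xᵀ)ᵀ + V * Xᵀ + s • (V * Xᵀ))) (V * Xᵀ) +
      2 * minner (gradφ (X * Xᵀ)) (V * Vᵀ) := by
  set M := X * Xᵀ with hM
  set F := V * Xᵀ with hF
  set W := V * Vᵀ with hW
  set E := Fᵀ + F with hE
  let γ : ℝ → Matrix (Fin n) (Fin n) ℝ := fun t => (X + t • V) * (X + t • V)ᵀ
  have hγ : ∀ t, γ t = M + t • E + (t * t) • W := by
    intro t
    simp only [γ, hM, hE, hF, hW, Matrix.transpose_add, Matrix.transpose_smul, Matrix.add_mul,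
      Matrix.mul_add, Matrix.transpose_mul, Matrix.transpose_transpose, smul_add,
      Matrix.smul_mul, Matrix.mul_smul, smul_smul]
    abel
  have hD : HasDerivAt (fun t : ℝ => 2 * minner (gradφ (γ t)) F + 2 * t * minner (gradφ (γ t)) W)
      (minner HV V) 0 := by
    have h : HasDerivAt (fun t : ℝ => ∑ i, ∑ j,
        ((2 : ℝ) • (gradφ ((X + t • V) * (X + t • V)ᵀ) * (X + t • V))) i j * V i j)
        (∑ i, ∑ j, HV i j * V i j) 0 :=
      HasDerivAt.fun_sum fun i _ => HasDerivAt.fun_sum fun j _ => (hf i j).mul_const _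
    refine h.congr_of_eventuallyEq (Eventually.of_forall fun t => ?_)
    change _ = minner ((2 : ℝ) • (gradφ (γ t) * (X + t • V))) V
    rw [minner_smul_left, minner_mul_left]
    simp only [Matrix.transpose_add, Matrix.transpose_smul, Matrix.mul_add, Matrix.mul_smul,
      minner_add_right, minner_smul_right]
    ring
  have hγ0 : γ 0 = M := by rw [hγ]; simp
  have hγc : Continuous γ := by
    have : γ = fun t => M + t • E + (t * t) • W := funext hγ
    rw [this]; fun_prop
  have hgW : Tendsto (fun t => minner (gradφ (γ t)) W) (𝓝[>] 0) (𝓝 (minner (gradφ M) W)) := by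
    refine ((grad_tendsto hconv hgrad M W).comp ?_).mono_left nhdsWithin_le_nhds
    simpa [hγ0] using hγc.tendsto 0
  have hkW : Tendsto (fun t : ℝ => minner (gradφ (M + t • (E + s • F))) W) (𝓝[>] 0)
      (𝓝 (minner (gradφ M) W)) := by
    have := (hhessφ M (E + s • F) W).continuousAt.tendsto
    simp only [zero_smul, add_zero] at this
    exact this.mono_left nhdsWithin_le_nhds
  have hsl := hD.tendsto_slope_zero_right
  have hup := (((hess_slope hhessφ M (E + s • F) F).const_mul 2).add (hgW.const_mul 2)).add
    ((hgW.sub hkW).const_mul (2 / s))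
  rw [sub_self, mul_zero, add_zero] at hup
  refine le_of_tendsto_of_tendsto hsl hup ?_
  filter_upwards [self_mem_nhdsWithin] with t ht
  have ht : 0 < t := ht
  have hm := grad_mono hconv hgrad (γ t) (M + t • (E + s • F))
  have e : γ t - (M + t • (E + s • F)) = t • (t • W - s • F) := by
    rw [hγ]; module
  rw [e, minner_smul_right] at hm
  have hm' := nonneg_of_mul_nonneg_right hm ht
  rw [minner_sub_right, minner_smul_right, minner_smul_right, minner_sub_left,
    minner_sub_left] at hm'
  simp only [zero_add, hγ0, smul_eq_mul, mul_zero, zero_mul, add_zero]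
  set a := minner (gradφ (γ t)) F
  set b := minner (gradφ (γ t)) W
  set c := minner (gradφ (M + t • (E + s • F))) F
  set d := minner (gradφ (M + t • (E + s • F))) W
  set g := minner (gradφ M) F
  have h1 : a - c ≤ t * (b - d) / s := by
    rw [le_div_iff₀ hs]; linarith
  have h2 : t⁻¹ * (2 * a + 2 * t * b - 2 * g) = 2 * (t⁻¹ * (c - g)) + 2 * b + 2 * t⁻¹ * (a - c) := by
    field_simp
    ring
  have h3 : 2 / s * (b - d) = 2 * t⁻¹ * (t * (b - d) / s) := by
    field_simp
  rw [h2, h3]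
  gcongr

end calculus

/-- Proposition 5, certificate of global optimality.
Here `f X = φ (X Xᵀ)`, `∇f(X) = 2 ∇φ(X Xᵀ) X`, and `hessf X V = ∇²f(X)[V]` is
the Hessian of `f`, specified through the limit definition
`∇²f(X)[V] = lim_{t→0} (∇f(X+tV) − ∇f(X))/t` (hypothesis `hhessf`).
The operator norm `‖∇²φ(XXᵀ)‖ = sup {‖∇²φ(XXᵀ)[E]‖_F : ‖E‖_F = 1}` appears in `Cλ`. -/
theorem certificate_of_global_optimality
    {n r : ℕ}
    (φ : Matrix (Fin n) (Fin n) ℝ → ℝ)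
    (gradφ : Matrix (Fin n) (Fin n) ℝ → Matrix (Fin n) (Fin n) ℝ)
    (hessφ : Matrix (Fin n) (Fin n) ℝ → Matrix (Fin n) (Fin n) ℝ → Matrix (Fin n) (Fin n) ℝ)
    (hessf : Matrix (Fin n) (Fin r) ℝ → Matrix (Fin n) (Fin r) ℝ → Matrix (Fin n) (Fin r) ℝ)
    (hconv : ConvexOn ℝ Set.univ φ)
    (hgrad : IsGradientOf φ gradφ)
    (hhessφ : IsHessianOf gradφ hessφ)
    (hhessf : ∀ (X V : Matrix (Fin n) (Fin r) ℝ) (i : Fin n) (j : Fin r),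
      HasDerivAt
        (fun t : ℝ => ((2 : ℝ) • (gradφ ((X + t • V) * (X + t • V)ᵀ) * (X + t • V))) i j)
        (hessf X V i j) 0)
    (Xstar : Matrix (Fin n) (Fin r) ℝ)
    (hmin : ∀ Y : Matrix (Fin n) (Fin r) ℝ, φ (Xstar * Xstarᵀ) ≤ φ (Y * Yᵀ))
    (X : Matrix (Fin n) (Fin r) ℝ)
    (εg εH εlam : ℝ) (hεg : 0 ≤ εg) (hεH : 0 ≤ εH) (hεlam : 0 ≤ εlam)
    (hlam : lamMin (Xᵀ * X) ≤ εlam)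
    (hgb : ∀ V : Matrix (Fin n) (Fin r) ℝ,
      minner ((2 : ℝ) • (gradφ (X * Xᵀ) * X)) V ≤ εg * frobNorm V)
    (hhb : ∀ V : Matrix (Fin n) (Fin r) ℝ,
      -(εH * (frobNorm V) ^ 2) ≤ minner (hessf X V) V) :
    φ (X * Xᵀ) - φ (Xstar * Xstarᵀ) ≤
      frobNorm X / 2 * εg + (frobNorm Xstar) ^ 2 / 2 * εH +
        2 * sSup ((fun E : Matrix (Fin n) (Fin n) ℝ =>
            frobNorm (hessφ (X * Xᵀ) E)) '' {E | frobNorm E = 1}) *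
          (frobNorm Xstar) ^ 2 * εlam := by
  set L := sSup ((fun E : Matrix (Fin n) (Fin n) ℝ =>
            frobNorm (hessφ (X * Xᵀ) E)) '' {E | frobNorm E = 1}) with hL
  have hL0 : 0 ≤ L := by
    refine Real.sSup_nonneg ?_
    rintro _ ⟨E, _, rfl⟩
    exact frobNorm_nonneg _
  have hX0 := frobNorm_nonneg X
  rcases Nat.eq_zero_or_pos r with hr | hr
  · subst hr
    have : X = Xstar := by ext i j; exact j.elim0
    rw [this, sub_self]
    have := frobNorm_nonneg Xstar
    positivity
  set G := gradφ (X * Xᵀ) with hG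
  -- second order bound
  have hV : ∀ V : Matrix (Fin n) (Fin r) ℝ, -(εH * (frobNorm V) ^ 2) ≤
      4 * L * frobNorm (V * Xᵀ) ^ 2 + 2 * minner G (V * Vᵀ) := by
    intro V
    refine (hhb V).trans (le_of_forall_pos_le_add fun δ hδ => ?_)
    set F := V * Xᵀ with hF
    have hF0 := frobNorm_nonneg F
    set s := δ / (2 * L * frobNorm F ^ 2 + 1) with hs
    have hs0 : 0 < s := by positivity
    have h1 := hessf_bound hconv hgrad hhessφ X V (hessf X V) (hhessf X V) hs0
    have h2 := minner_le (hessφ (X * Xᵀ) (Fᵀ + F + s • F)) F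
    have h3 := hess_le hconv hgrad hhessφ (X * Xᵀ) (Fᵀ + F + s • F)
    have h4 := frob_sym_bound F hs0
    have h5 : minner (hessφ (X * Xᵀ) (Fᵀ + F + s • F)) F ≤ L * ((2 + s) * frobNorm F) * frobNorm F :=
      h2.trans (mul_le_mul_of_nonneg_right
        (h3.trans (mul_le_mul_of_nonneg_left h4 hL0)) hF0)
    have h6 : s * (2 * L * frobNorm F ^ 2 + 1) = δ := by
      rw [hs]; exact div_mul_cancel₀ _ (by positivity)
    nlinarith
  -- curvature of G
  have hu : ∀ u : Fin n → ℝ, -(∑ i, ∑ j, G i j * (u i * u j)) ≤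
      (∑ i, u i ^ 2) * (εH / 2 + 2 * L * εlam) := by
    intro u
    set U := ∑ i, u i ^ 2 with hU
    have hU0 : 0 ≤ U := by positivity
    refine le_of_forall_pos_le_add fun δ hδ => ?_
    set η := δ / (2 * L * U + 1) with hη
    have hη0 : 0 < η := by positivity
    have hlt : lamMin (Xᵀ * X) < εlam + η := by linarith
    obtain ⟨_, ⟨v, hv1, rfl⟩, hv2⟩ := exists_lt_of_csInf_lt (by
      refine ⟨_, Pi.single ⟨0, hr⟩ 1, ?_, rfl⟩
      rw [Finset.sum_eq_single ⟨0, hr⟩]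
      · simp
      · intro b _ hb; simp [hb]
      · simp) hlt
    have hv3 : ∑ i, (X *ᵥ v) i ^ 2 < εlam + η := by
      refine lt_of_eq_of_lt ?_ hv2
      have h := Matrix.dotProduct_mulVec v Xᵀ (X *ᵥ v)
      rw [Matrix.vecMul_transpose, Matrix.mulVec_mulVec] at h
      simp only [dotProduct] at h
      simp only [sq]
      rw [← h]
      exact Finset.sum_congr rfl fun i _ => mul_comm _ _
    have h := hV (Matrix.vecMulVec u v)
    have hn1 : frobNorm (Matrix.vecMulVec u v) ^ 2 = U := by
      rw [frobNorm_sq']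
      simp only [Matrix.vecMulVec_apply, mul_pow, ← Finset.mul_sum, hv1, mul_one]
      rfl
    have hn2 : frobNorm (Matrix.vecMulVec u v * Xᵀ) ^ 2 = U * ∑ i, (X *ᵥ v) i ^ 2 := by
      rw [Matrix.vecMulVec_mul, Matrix.vecMul_transpose, frobNorm_sq']
      simp only [Matrix.vecMulVec_apply, mul_pow, ← Finset.mul_sum, ← Finset.sum_mul]
      rfl
    have hn3 : minner G (Matrix.vecMulVec u v * (Matrix.vecMulVec u v)ᵀ) =
        ∑ i, ∑ j, G i j * (u i * u j) := by
      rw [minner]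
      refine Finset.sum_congr rfl fun i _ => Finset.sum_congr rfl fun j _ => ?_
      congr 1
      simp only [Matrix.mul_apply, Matrix.transpose_apply, Matrix.vecMulVec_apply]
      have : ∀ x, u i * v x * (u j * v x) = (u i * u j) * v x ^ 2 := fun x => by ring
      simp only [this, ← Finset.mul_sum, hv1, mul_one]
    rw [hn1, hn2, hn3] at h
    have h6 : η * (2 * L * U + 1) = δ := by
      rw [hη]; exact div_mul_cancel₀ _ (by positivity)
    have h7 : 4 * L * (U * ∑ i, (X *ᵥ v) i ^ 2) ≤ 4 * L * (U * (εlam + η)) := by gcongr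
    nlinarith
  have hstar : -(minner G (Xstar * Xstarᵀ)) ≤
      frobNorm Xstar ^ 2 * (εH / 2 + 2 * L * εlam) := by
    have h := Finset.sum_le_sum (s := (Finset.univ : Finset (Fin r)))
      (fun k _ => hu (fun i => Xstar i k))
    rw [Finset.sum_neg_distrib, ← Finset.sum_mul] at h
    have e1 : minner G (Xstar * Xstarᵀ) =
        ∑ k, ∑ i, ∑ j, G i j * (Xstar i k * Xstar j k) := by
      rw [Finset.sum_comm, minner]
      refine Finset.sum_congr rfl fun i _ => ?_
      rw [Finset.sum_comm]
      refine Finset.sum_congr rfl fun j _ => ?_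
      rw [← Finset.mul_sum, Matrix.mul_apply]
      rfl
    have e2 : frobNorm Xstar ^ 2 = ∑ k, ∑ i, Xstar i k ^ 2 := by
      rw [frobNorm_sq', Finset.sum_comm]
    rw [e1, e2]
    exact h
  have hfirst := grad_ineq hconv hgrad (X * Xᵀ) (Xstar * Xstarᵀ - X * Xᵀ)
  rw [add_sub_cancel, minner_sub_right] at hfirst
  have hg := hgb X
  rw [minner_smul_left, minner_mul_left] at hg
  nlinarith
end
end

section
/- Let φ: ℝ^{n×n} → ℝ be L-gradient Lipschitz and (μ,2r)-restricted strongly convex, and let the global minimizer M⋆ = argmin φ satisfy M⋆ ⪰ 0 and rank(M⋆) ≤ r. Define f(X) = φ(XXᵀ) for X ∈ ℝ^{n×r}, and let X⋆ ∈ ℝ^{n×r} be a global minimizer of f. Then for every X ∈ ℝ^{n×r}: (μ/2)·‖XXᵀ − M⋆‖_F² ≤ f(X) − f(X⋆) ≤ (L/2)·‖XXᵀ − M⋆‖_F². -/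
open Matrix

noncomputable section

theorem aux_mvt (f f' : ℝ → ℝ) (hf : ∀ t, HasDerivAt f (f' t) t)
    (h0 : ∀ t, 0 < t → 0 ≤ f' t) (t : ℝ) (ht : 0 ≤ t) : f 0 ≤ f t := by
  rcases ht.eq_or_lt with rfl | ht
  · exact le_rfl
  · obtain ⟨c, hc, h⟩ := exists_hasDerivAt_eq_slope f f' ht
      (fun x _ => (hf x).continuousAt.continuousWithinAt) (fun x _ => hf x)
    have h1 := h0 c hc.1
    rw [h, sub_zero] at h1
    have h2 : 0 ≤ (f t - f 0) / t * t := mul_nonneg h1 ht.le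
    rw [div_mul_cancel₀ _ ht.ne'] at h2
    linarith

theorem aux_frob_sq {m r : Type*} [Fintype m] [Fintype r] (A : Matrix m r ℝ) :
    frobNorm A ^ 2 = ∑ i, ∑ j, (A i j) ^ 2 := by
  unfold frobNorm
  exact Real.sq_sqrt (Finset.sum_nonneg fun i _ => Finset.sum_nonneg fun j _ => sq_nonneg _)

theorem aux_cs {m r : Type*} [Fintype m] [Fintype r] (A B : Matrix m r ℝ) :
    minner A B ≤ frobNorm A * frobNorm B := by
  unfold minner frobNorm
  have h := Real.sum_mul_le_sqrt_mul_sqrt (Finset.univ : Finset (m × r))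
    (fun p => A p.1 p.2) (fun p => B p.1 p.2)
  simpa only [Fintype.sum_prod_type] using h

theorem aux_frob_smul {m r : Type*} [Fintype m] [Fintype r] (t : ℝ) (ht : 0 ≤ t)
    (A : Matrix m r ℝ) : frobNorm (t • A) = t * frobNorm A := by
  unfold frobNorm
  simp only [Matrix.smul_apply, smul_eq_mul, mul_pow, ← Finset.mul_sum]
  rw [Real.sqrt_mul (sq_nonneg t), Real.sqrt_sq ht]

theorem aux_minner_sub {m r : Type*} [Fintype m] [Fintype r] (A B C : Matrix m r ℝ) :
    minner (A - B) C = minner A C - minner B C := by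
  unfold minner
  simp only [Matrix.sub_apply, sub_mul, Finset.sum_sub_distrib]

theorem aux_rank_smul {n : ℕ} (c : ℝ) (A : Matrix (Fin n) (Fin n) ℝ) :
    (c • A).rank ≤ A.rank := by
  have : c • A = A * (c • (1 : Matrix (Fin n) (Fin n) ℝ)) := by simp
  rw [this]
  exact Matrix.rank_mul_le_left _ _

theorem aux_rank_add {n : ℕ} (A B : Matrix (Fin n) (Fin n) ℝ) :
    (A + B).rank ≤ A.rank + B.rank := by
  unfold Matrix.rank
  rw [Matrix.mulVecLin_add]
  refine (Submodule.finrank_mono (LinearMap.range_add_le _ _)).trans ?_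
  exact Submodule.finrank_add_le_finrank_add_finrank _ _

theorem aux_factor {n r : ℕ} (M : Matrix (Fin n) (Fin n) ℝ) (hpsd : M.PosSemidef)
    (hrank : M.rank ≤ r) : ∃ Y : Matrix (Fin n) (Fin r) ℝ, Y * Yᵀ = M := by
  classical
  have hH := hpsd.isHermitian
  rw [hH.rank_eq_card_non_zero_eigs] at hrank
  have : Fintype.card {i // hH.eigenvalues i ≠ 0} ≤ Fintype.card (Fin r) := by simpa using hrank
  obtain ⟨e⟩ := Function.Embedding.nonempty_of_card_le this
  let P : Matrix (Fin n) (Fin r) ℝ := fun j k =>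
    if h : hH.eigenvalues j ≠ 0 then (if e ⟨j, h⟩ = k then Real.sqrt (hH.eigenvalues j) else 0)
    else 0
  have hP : P * Pᵀ = Matrix.diagonal hH.eigenvalues := by
    ext i j
    rw [Matrix.mul_apply, Matrix.diagonal_apply]
    simp only [Matrix.transpose_apply]
    simp only [P]
    by_cases hi : hH.eigenvalues i ≠ 0
    · by_cases hj : hH.eigenvalues j ≠ 0
      · simp only [dif_pos hi, dif_pos hj, ite_mul, zero_mul, Finset.sum_ite_eq,
          Finset.mem_univ, if_true]
        by_cases hij : i = j
        · subst hij
          simp [Real.mul_self_sqrt (hpsd.eigenvalues_nonneg i)]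
        · have : e ⟨j, hj⟩ ≠ e ⟨i, hi⟩ := by
            intro h
            exact hij (by simpa using (e.injective h).symm)
          simp [hij, this]
      · have hij : i ≠ j := by rintro rfl; exact hj hi
        simp [hj, hij]
    · simp only [dif_neg hi, zero_mul, Finset.sum_const_zero]
      push Not at hi
      simp [hi]
  refine ⟨(hH.eigenvectorUnitary : Matrix (Fin n) (Fin n) ℝ) * P, ?_⟩
  have hs := hH.spectral_theorem
  rw [Unitary.conjStarAlgAut_apply] at hs
  rw [Matrix.transpose_mul, Matrix.mul_assoc, ← Matrix.mul_assoc P, hP, ← Matrix.mul_assoc]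
  conv_rhs => rw [hs]
  rfl

/-- Lemma 10, preservation of the error norm.
With `f X = φ (X Xᵀ)` and `X⋆` a global minimizer of `f`,
`(μ/2)‖XXᵀ − M⋆‖_F² ≤ f(X) − f(X⋆) ≤ (L/2)‖XXᵀ − M⋆‖_F²`. -/
theorem preservation_of_error_norm
    {n r : ℕ}
    (φ : Matrix (Fin n) (Fin n) ℝ → ℝ)
    (gradφ : Matrix (Fin n) (Fin n) ℝ → Matrix (Fin n) (Fin n) ℝ)
    (hessφ : Matrix (Fin n) (Fin n) ℝ → Matrix (Fin n) (Fin n) ℝ → Matrix (Fin n) (Fin n) ℝ)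
    (L μ : ℝ) (hL : 0 < L) (hμ : 0 < μ)
    (hgrad : IsGradientOf φ gradφ)
    (hhess : IsHessianOf gradφ hessφ)
    (hLip : GradLipschitz gradφ L)
    (hRSC : RestrictedStronglyConvex hessφ μ (2 * r))
    (Mstar : Matrix (Fin n) (Fin n) ℝ)
    (hmin : ∀ M : Matrix (Fin n) (Fin n) ℝ, φ Mstar ≤ φ M)
    (hpsd : Mstar.PosSemidef)
    (hrank : Mstar.rank ≤ r)
    (Xstar : Matrix (Fin n) (Fin r) ℝ)
    (hfmin : ∀ Y : Matrix (Fin n) (Fin r) ℝ, φ (Xstar * Xstarᵀ) ≤ φ (Y * Yᵀ))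
    (X : Matrix (Fin n) (Fin r) ℝ) :
    μ / 2 * (frobNorm (X * Xᵀ - Mstar)) ^ 2 ≤ φ (X * Xᵀ) - φ (Xstar * Xstarᵀ) ∧
      φ (X * Xᵀ) - φ (Xstar * Xstarᵀ) ≤ L / 2 * (frobNorm (X * Xᵀ - Mstar)) ^ 2 := by
  obtain ⟨Y, hY⟩ := aux_factor Mstar hpsd hrank
  have hval : φ (Xstar * Xstarᵀ) = φ Mstar :=
    le_antisymm (hY ▸ hfmin Y) (hmin _)
  rw [hval]
  set E := X * Xᵀ - Mstar with hE
  have hXE : X * Xᵀ = Mstar + (1 : ℝ) • E := by simp [hE]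
  have hrX : (X * Xᵀ).rank ≤ r := by
    refine (Matrix.rank_mul_le_left _ _).trans ?_
    simpa using Matrix.rank_le_width X
  have hshift : ∀ t s : ℝ, Mstar + t • E + (s - t) • E = Mstar + s • E := by
    intro t s
    rw [add_assoc, ← add_smul, add_sub_cancel]
  have hg : ∀ t : ℝ, HasDerivAt (fun t : ℝ => φ (Mstar + t • E))
      (minner (gradφ (Mstar + t • E)) E) t := by
    intro t
    have h := hgrad (Mstar + t • E) E
    rw [← sub_self t] at h
    have h2 := h.comp_sub_const t t
    simpa only [hshift] using h2
  have hg2 : ∀ t : ℝ, HasDerivAt (fun t : ℝ => minner (gradφ (Mstar + t • E)) E)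
      (minner (hessφ (Mstar + t • E) E) E) t := by
    intro t
    have h := hhess (Mstar + t • E) E E
    rw [← sub_self t] at h
    have h2 := h.comp_sub_const t t
    simpa only [hshift] using h2
  have hg0 : minner (gradφ Mstar) E = 0 := by
    have h := hgrad Mstar E
    refine IsLocalMin.hasDerivAt_eq_zero (Filter.Eventually.of_forall fun t => ?_) h
    simpa using hmin _
  have hrE : E.rank ≤ 2 * r := by
    rw [hE, sub_eq_add_neg, ← neg_one_smul ℝ Mstar]
    have h1 := aux_rank_add (X * Xᵀ) ((-1 : ℝ) • Mstar)
    have h2 := aux_rank_smul (-1) Mstar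
    omega
  have hrM : ∀ t : ℝ, (Mstar + t • E).rank ≤ 2 * r := by
    intro t
    have : Mstar + t • E = (1 - t) • Mstar + t • (X * Xᵀ) := by
      rw [hE, smul_sub, sub_smul, one_smul]; abel
    rw [this]
    have h1 := aux_rank_add ((1 - t) • Mstar) (t • (X * Xᵀ))
    have h2 := aux_rank_smul (1 - t) Mstar
    have h3 := aux_rank_smul t (X * Xᵀ)
    omega
  set S := frobNorm E ^ 2 with hS
  have hsq : ∀ c t : ℝ, HasDerivAt (fun t : ℝ => c / 2 * S * t ^ 2) (c * S * t) t := by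
    intro c t
    have h := (hasDerivAt_pow 2 t).const_mul (c / 2 * S)
    have heq : c / 2 * S * (((2 : ℕ) : ℝ) * t ^ (2 - 1)) = c * S * t := by
      norm_num
      ring
    exact heq ▸ h
  have hlow : ∀ t : ℝ, 0 ≤ t → μ * S * t ≤ minner (gradφ (Mstar + t • E)) E := by
    intro t ht
    have h := aux_mvt (fun t => minner (gradφ (Mstar + t • E)) E - μ * S * t)
      (fun t => minner (hessφ (Mstar + t • E) E) E - μ * S * 1)
      (fun t => (hg2 t).sub ((hasDerivAt_id t).const_mul _))
      (fun t _ => by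
        have := hRSC _ E (hrM t) hrE
        simp only [mul_one]
        linarith) t ht
    simp only [zero_smul, add_zero, hg0, mul_zero, sub_zero] at h
    linarith
  have hup : ∀ t : ℝ, 0 ≤ t → minner (gradφ (Mstar + t • E)) E ≤ L * S * t := by
    intro t ht
    have h1 := aux_cs (gradφ (Mstar + t • E) - gradφ Mstar) E
    rw [aux_minner_sub, hg0, sub_zero] at h1
    have h2 := hLip Mstar (t • E)
    rw [aux_frob_smul t ht] at h2
    have h3 : 0 ≤ frobNorm E := Real.sqrt_nonneg _
    have h4 := mul_le_mul_of_nonneg_right h2 h3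
    rw [hS]
    nlinarith
  have hA := aux_mvt (fun t => φ (Mstar + t • E) - μ / 2 * S * t ^ 2) _
    (fun t => (hg t).sub (hsq μ t)) (fun t ht => by have := hlow t ht.le; linarith)
    1 zero_le_one
  have hB := aux_mvt (fun t => L / 2 * S * t ^ 2 - φ (Mstar + t • E)) _
    (fun t => (hsq L t).sub (hg t)) (fun t ht => by have := hup t ht.le; linarith)
    1 zero_le_one
  simp only [zero_smul, add_zero] at hA hB
  rw [← hXE] at hA hB
  constructor
  · linarith
  · linarith
end
end

section
/- Let M⋆ ∈ ℝ^{n×n} satisfy M⋆ ⪰ 0 with r⋆ = rank(M⋆), and suppose X ∈ ℝ^{n×r} satisfies ‖XXᵀ − M⋆‖_F ≤ ρ·λ_{r⋆}(M⋆) for some 0 < ρ < 1/√2. Then ‖(I − XX†)·M⋆·(I − XX†)‖_F ≤ (1/√2)·(ρ/√(1−ρ²))·‖XXᵀ − M⋆‖_F, where X† denotes the Moore–Penrose pseudoinverse of X. -/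
open Matrix

noncomputable section

/-- The `i`-th largest eigenvalue (indexing from `i = 0`) of a Hermitian real matrix:
the eigenvalues sorted in increasing order, read in reverse. -/
def eigsDesc {n : ℕ} {A : Matrix (Fin n) (Fin n) ℝ} (hA : A.IsHermitian) (i : Fin n) : ℝ :=
  hA.eigenvalues (Tuple.sort hA.eigenvalues i.rev)

/-- `B` is the Moore–Penrose pseudoinverse of `A` (the four Penrose conditions,
which characterize the pseudoinverse uniquely). -/
def IsMoorePenrose {m r : Type*} [Fintype m] [Fintype r]
    (A : Matrix m r ℝ) (B : Matrix r m ℝ) : Prop :=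
  A * B * A = A ∧ B * A * B = B ∧ (A * B)ᵀ = A * B ∧ (B * A)ᵀ = B * A


lemma frob_sq {m r : Type*} [Fintype m] [Fintype r] (A : Matrix m r ℝ) :
    (frobNorm A) ^ 2 = (A * Aᵀ).trace := by
  unfold frobNorm
  have h : 0 ≤ ∑ i, ∑ j, (A i j) ^ 2 :=
    Finset.sum_nonneg fun i _ => Finset.sum_nonneg fun j _ => sq_nonneg _
  rw [Real.sq_sqrt h]
  simp [Matrix.trace, Matrix.mul_apply, sq]

lemma psd_trace_sq {n : ℕ} (S : Matrix (Fin n) (Fin n) ℝ) (hS : S.PosSemidef) :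
    frobNorm S ≤ S.trace := by
  unfold frobNorm
  refine Real.sqrt_le_iff.mpr ⟨hS.trace_nonneg, ?_⟩
  rw [sq, Matrix.trace, Finset.sum_mul_sum]
  refine Finset.sum_le_sum fun i _ => Finset.sum_le_sum fun j _ => ?_
  have h := (hS.submatrix ![i, j]).det_nonneg
  rw [Matrix.det_fin_two] at h
  have h2 : S j i = S i j := by simpa using hS.isHermitian.apply i j
  simp [h2] at h
  simp only [Matrix.diag_apply]
  nlinarith

lemma eig_ge {n : ℕ} (M : Matrix (Fin n) (Fin n) ℝ) (hM : M.PosSemidef) (i : Fin n)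
    (hi : (i : ℕ) + 1 = M.rank) (j : Fin n) (hj : hM.isHermitian.eigenvalues j ≠ 0) :
    eigsDesc hM.isHermitian i ≤ hM.isHermitian.eigenvalues j := by
  by_contra! hlt
  have hpos : 0 < hM.isHermitian.eigenvalues j :=
    lt_of_le_of_ne (hM.eigenvalues_nonneg j) (Ne.symm hj)
  have hmono := Tuple.monotone_sort hM.isHermitian.eigenvalues
  set ev := hM.isHermitian.eigenvalues with hev
  set σ := Tuple.sort ev with hσ
  have hk : ev (σ (σ.symm j)) = ev j := by simp
  have hklt : σ.symm j < i.rev := by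
    by_contra! h
    have := hmono h
    simp only [Function.comp, hk] at this
    exact absurd hlt (not_lt.mpr this)
  have hcard : (Finset.Ici (σ.symm j)).card ≤ M.rank := by
    rw [hM.isHermitian.rank_eq_card_non_zero_eigs, Fintype.card_subtype]
    refine Finset.card_le_card_of_injOn σ ?_ σ.injective.injOn
    intro m hm
    have := hmono (Finset.mem_Ici.mp hm)
    simp only [Function.comp, hk] at this
    simp only [Finset.coe_filter, Finset.mem_univ, true_and, Set.mem_ofPred_eq]
    exact (hpos.trans_le this).ne'
  rw [Fin.card_Ici, ← hi] at hcard
  have h1 : (σ.symm j : ℕ) < n - (i + 1) := by simpa [Fin.lt_def, Fin.val_rev] using hklt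
  omega

lemma sq_sub_psd {n : ℕ} (M : Matrix (Fin n) (Fin n) ℝ) (hM : M.PosSemidef) (l : ℝ)
    (h : ∀ j, hM.isHermitian.eigenvalues j ≠ 0 → l ≤ hM.isHermitian.eigenvalues j) :
    (M * M - l • M).PosSemidef := by
  set ev := hM.isHermitian.eigenvalues with hev
  obtain ⟨U, hU, hs⟩ : ∃ U : Matrix (Fin n) (Fin n) ℝ, Uᴴ * U = 1 ∧
      M = U * diagonal ev * Uᴴ := by
    refine ⟨hM.isHermitian.eigenvectorUnitary, ?_, ?_⟩
    · exact Unitary.coe_star_mul_self hM.isHermitian.eigenvectorUnitary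
    · have := hM.isHermitian.spectral_theorem
      rw [Unitary.conjStarAlgAut_apply] at this
      exact this
  have hd : (diagonal (fun j => ev j * ev j - l * ev j)).PosSemidef := by
    refine Matrix.PosSemidef.diagonal fun j => ?_
    by_cases hj : ev j = 0
    · simp [hj]
    · have := h j hj
      have h0 : 0 ≤ ev j := hM.eigenvalues_nonneg j
      simp only [Pi.zero_apply]
      nlinarith
  have := hd.mul_mul_conjTranspose_same U
  convert this using 1
  have e : diagonal (fun j => ev j * ev j - l * ev j)
      = diagonal ev * diagonal ev - l • diagonal ev := by
    rw [diagonal_mul_diagonal, ← diagonal_smul, diagonal_sub]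
    rfl
  rw [e, mul_sub, sub_mul]
  have : M * M = U * (diagonal ev * diagonal ev) * Uᴴ := by
    rw [hs]
    calc _ = U * diagonal ev * (Uᴴ * U) * diagonal ev * Uᴴ := by simp only [mul_assoc]
      _ = _ := by rw [hU]; simp only [mul_assoc, mul_one]
  rw [this]
  conv_lhs => rw [hs]
  simp

lemma final_real (d e l ρ : ℝ) (hd : 0 ≤ d) (hρ0 : 0 < ρ) (hρ : ρ < 1 / Real.sqrt 2)
    (hde : d ≤ e) (hel : e ≤ ρ * l) (h : 2 * l * d - d ^ 2 ≤ e ^ 2) :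
    d ≤ 1 / Real.sqrt 2 * (ρ / Real.sqrt (1 - ρ ^ 2)) * e := by
  have h2 : Real.sqrt 2 ^ 2 = 2 := Real.sq_sqrt (by norm_num)
  have h2p : 0 < Real.sqrt 2 := by positivity
  have hr : ρ * Real.sqrt 2 < 1 := by rwa [lt_div_iff₀ h2p] at hρ
  have hρ2 : ρ ^ 2 < 1 / 2 := by nlinarith [mul_pos hρ0 h2p]
  set s := Real.sqrt (1 - ρ ^ 2) with hs
  have hs2 : s ^ 2 = 1 - ρ ^ 2 := Real.sq_sqrt (by linarith)
  have hsp : 0 < s := Real.sqrt_pos.mpr (by linarith)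
  have hs1 : s < 1 := by nlinarith
  have hρ1 : ρ < 1 := by nlinarith
  have h22 : Real.sqrt 2 ≤ 2 := by nlinarith
  -- key quadratic
  have hq : 2 * e * d - ρ * d ^ 2 ≤ ρ * e ^ 2 := by
    nlinarith [mul_le_mul_of_nonneg_right hel hd]
  have key : d * (1 + s) ≤ ρ * e := by
    by_contra! hc
    have hpos : 0 ≤ e := hd.trans hde
    -- (ρ d - (1 - s) e) (ρ d - (1 + s) e) ≥ 0
    have hprod : 0 ≤ (ρ * d - (1 - s) * e) * (ρ * d - (1 + s) * e) := by
      have : (ρ * d - (1 - s) * e) * (ρ * d - (1 + s) * e)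
        = ρ * (ρ * e ^ 2 - (2 * e * d - ρ * d ^ 2)) + e ^ 2 * (1 - ρ ^ 2 - s ^ 2) := by ring
      rw [this, hs2]
      nlinarith
    have hdpos : 0 < d := by
      by_contra! h0
      have : d = 0 := le_antisymm h0 hd
      subst this
      nlinarith [mul_nonneg hρ0.le hpos]
    have a : 0 < ρ * d - (1 - s) * e := by
      have : 0 < ρ * (d * (1 + s) - ρ * e) := mul_pos hρ0 (by linarith)
      have h3 : ρ * (d * (1 + s) - ρ * e) = (1 + s) * (ρ * d - (1 - s) * e) + (1 - ρ ^ 2 - s ^ 2) * e := by ring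
      rw [h3, hs2] at this
      have h4 : 0 < (1 + s) * (ρ * d - (1 - s) * e) := by linarith
      exact (mul_pos_iff_of_pos_left (by linarith)).mp h4
    have b : ρ * d - (1 + s) * e < 0 := by nlinarith
    nlinarith
  have e1 : 1 / Real.sqrt 2 * (ρ / s) * e = ρ * e / (Real.sqrt 2 * s) := by
    field_simp
  rw [e1, le_div_iff₀ (by positivity)]
  refine le_trans (mul_le_mul_of_nonneg_left ?_ hd) key
  nlinarith

/-- Lemma 12, basis alignment.  `Xd` is the Moore–Penrose
pseudoinverse of `X`, so `X Xd` is the orthogonal projector onto the column space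
of `X`; `eigsDesc hM.isHermitian i` with `i + 1 = r⋆ = rank M⋆` is `λ_{r⋆}(M⋆)`. -/
theorem basis_alignment
    {n r rstar : ℕ}
    (Mstar : Matrix (Fin n) (Fin n) ℝ) (hM : Mstar.PosSemidef)
    (hrank : Mstar.rank = rstar)
    (i : Fin n) (hi : (i : ℕ) + 1 = rstar)
    (X : Matrix (Fin n) (Fin r) ℝ)
    (Xd : Matrix (Fin r) (Fin n) ℝ) (hXd : IsMoorePenrose X Xd)
    (ρ : ℝ) (hρ0 : 0 < ρ) (hρ : ρ < 1 / Real.sqrt 2)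
    (hclose : frobNorm (X * Xᵀ - Mstar) ≤ ρ * eigsDesc hM.isHermitian i) :
    frobNorm ((1 - X * Xd) * Mstar * (1 - X * Xd)) ≤
      1 / Real.sqrt 2 * (ρ / Real.sqrt (1 - ρ ^ 2)) * frobNorm (X * Xᵀ - Mstar) := by
  set M := Mstar with hMM
  obtain ⟨h1, h2, h3, h4⟩ := hXd
  set P := X * Xd with hP
  set l := eigsDesc hM.isHermitian i with hl
  have hPP : P * P = P := by
    calc P * P = P * X * Xd := by rw [hP, Matrix.mul_assoc (X * Xd) X Xd]
      _ = P := by rw [h1]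
  set Q := 1 - P with hQ
  have hQT : Qᵀ = Q := by rw [hQ, transpose_sub, h3, transpose_one]
  have hQQ : Q * Q = Q := by rw [hQ]; simp [mul_sub, sub_mul, hPP]
  have hQX : Q * X = 0 := by rw [hQ, Matrix.sub_mul, h1, Matrix.one_mul, sub_self]
  have hMT : Mᵀ = M := by simpa using hM.isHermitian.eq
  set E := X * Xᵀ - M with hE
  have hET : Eᵀ = E := by rw [hE]; simp [hMT]
  have hQE : Q * E = -(Q * M) := by rw [hE, mul_sub, ← Matrix.mul_assoc, hQX]; simp
  have hEQ : E * Q = -(M * Q) := by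
    have := congrArg transpose hQE
    simpa [transpose_mul, hQT, hET, hMT] using this
  clear_value E Q P
  have hd2 : frobNorm (Q * M * Q) ^ 2 = (M * Q * (M * Q)).trace := by
    rw [frob_sq]
    simp only [transpose_mul, hQT, hMT]
    calc (Q * M * Q * (Q * (M * Q))).trace = (Q * (M * (Q * Q) * M * Q)).trace := by
          simp only [mul_assoc]
      _ = (M * (Q * Q) * M * (Q * Q)).trace := by rw [trace_mul_comm]; simp only [mul_assoc]
      _ = _ := by rw [hQQ]; simp only [mul_assoc]
  have hPE : 0 ≤ (E * P * (E * P)).trace := by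
    have : frobNorm (P * E * P) ^ 2 = (E * P * (E * P)).trace := by
      rw [frob_sq]
      simp only [transpose_mul, h3, hET]
      calc (P * E * P * (P * (E * P))).trace = (P * (E * (P * P) * E * P)).trace := by
            simp only [mul_assoc]
        _ = (E * (P * P) * E * (P * P)).trace := by rw [trace_mul_comm]; simp only [mul_assoc]
        _ = _ := by rw [hPP]; simp only [mul_assoc]
    rw [← this]; positivity
  have hqm : (E * Q * E).trace = frobNorm (Q * M) ^ 2 := by
    rw [frob_sq, transpose_mul, hQT, hMT]
    calc (E * Q * E).trace = (E * Q * (Q * E)).trace := by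
          rw [← mul_assoc, mul_assoc E Q Q, hQQ]
      _ = (M * Q * (Q * M)).trace := by rw [hEQ, hQE]; simp
      _ = _ := trace_mul_comm _ _
  have he2 : frobNorm E ^ 2 = (E * P * (E * P)).trace + 2 * frobNorm (Q * M) ^ 2
      - frobNorm (Q * M * Q) ^ 2 := by
    have h5 : (M * Q * (M * Q)) = E * Q * (E * Q) := by rw [hEQ]; simp
    rw [hd2, ← hqm, h5, frob_sq, hET]
    have hPQ : E * P = E - E * Q := by rw [hQ]; simp [mul_sub]
    rw [hPQ]
    simp only [mul_sub, sub_mul, trace_sub]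
    have : (E * (E * Q)).trace = (E * Q * E).trace := trace_mul_comm _ _
    rw [this]; ring
  have hqmge : l * frobNorm (Q * M * Q) ≤ frobNorm (Q * M) ^ 2 := by
    have hpsd := sq_sub_psd M hM l (eig_ge M hM i (by rw [hi, hrank]))
    have hnn := (hpsd.mul_mul_conjTranspose_same Q).trace_nonneg
    have hS := hM.mul_mul_conjTranspose_same Q
    have hQH : Qᴴ = Q := by simpa using hQT
    rw [hQH] at hnn hS
    have ht := psd_trace_sq _ hS
    have hl0 : 0 ≤ l := hM.eigenvalues_nonneg _
    have : (Q * (M * M - l • M) * Q).trace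
        = frobNorm (Q * M) ^ 2 - l * (Q * M * Q).trace := by
      rw [frob_sq, transpose_mul, hQT, hMT, mul_sub, sub_mul, trace_sub]
      simp [mul_assoc]
    rw [this] at hnn
    nlinarith [mul_le_mul_of_nonneg_left ht hl0]
  have hdq : frobNorm (Q * M * Q) ^ 2 ≤ frobNorm (Q * M) ^ 2 := by
    have h6 : 0 ≤ frobNorm (Q * M * P) ^ 2 := sq_nonneg _
    have h7 : frobNorm (Q * M * P) ^ 2 = frobNorm (Q * M) ^ 2 - frobNorm (Q * M * Q) ^ 2 := by
      simp only [frob_sq, transpose_mul, hQT, hMT, h3]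
      have a : Q * M * P * (P * (M * Q)) = Q * M * P * (M * Q) := by
        rw [← mul_assoc, mul_assoc (Q * M) P P, hPP]
      have b : Q * M * Q * (Q * (M * Q)) = Q * M * Q * (M * Q) := by
        rw [← mul_assoc, mul_assoc (Q * M) Q Q, hQQ]
      rw [a, b, ← trace_sub, ← sub_mul]
      have c : P = 1 - Q := by rw [hQ]; simp
      rw [c, mul_sub, mul_one]
    linarith
  have hd0 : 0 ≤ frobNorm (Q * M * Q) := Real.sqrt_nonneg _
  have he0 : 0 ≤ frobNorm E := Real.sqrt_nonneg _
  refine final_real _ _ l ρ hd0 hρ0 hρ ?_ hclose ?_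
  · exact (sq_le_sq₀ hd0 he0).mp (by linarith)
  · linarith
end
end

section
/- Let H ∈ ℝ^{n×n} and X ∈ ℝ^{n×r}, define the linear map J: ℝ^{n×r} → ℝ^{n×n} by J(Y) = XYᵀ + YXᵀ, and let Y⋆ = J†(H) be the minimum-Frobenius-norm least-squares solution, i.e. Y⋆ is the unique minimizer of ‖Y‖_F over all minimizers Y of ‖J(Y) − H‖_F. Then ‖XY⋆ᵀ + Y⋆Xᵀ‖_F² ≥ 2·λ_k(XXᵀ)·‖Y⋆‖_F², where k = rank(X). -/
open Matrix

noncomputable section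

theorem aux_fsq {n r : ℕ} (A : Matrix (Fin n) (Fin r) ℝ) :
    frobNorm A ^ 2 = trace (A * Aᵀ) := by
  have h0 : 0 ≤ ∑ i, ∑ j, (A i j) ^ 2 :=
    Finset.sum_nonneg fun _ _ => Finset.sum_nonneg fun _ _ => sq_nonneg _
  refine (Real.sq_sqrt h0).trans ?_
  simp [trace, Matrix.mul_apply, sq]

theorem aux_tr_nonneg {n r : ℕ} (A : Matrix (Fin n) (Fin r) ℝ) :
    0 ≤ trace (A * Aᵀ) := by
  rw [← aux_fsq]; positivity

theorem aux_tr_zero {n r : ℕ} (A : Matrix (Fin n) (Fin r) ℝ) (h : trace (A * Aᵀ) = 0) :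
    A = 0 := by
  have := (Matrix.trace_mul_conjTranspose_self_eq_zero_iff (A := A))
  rw [Matrix.conjTranspose_eq_transpose_of_trivial] at this
  exact this.1 h

theorem aux_eig {n : ℕ} {A : Matrix (Fin n) (Fin n) ℝ} (hA : A.IsHermitian)
    (hp : A.PosSemidef) (i : Fin n) (hi : (i : ℕ) + 1 = A.rank) (j : Fin n)
    (hj : hA.eigenvalues j ≠ 0) : eigsDesc hA i ≤ hA.eigenvalues j := by
  by_contra! hlt
  have hpos : 0 < hA.eigenvalues j := lt_of_le_of_ne (hp.eigenvalues_nonneg j) hj.symm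
  have hmono := Tuple.monotone_sort hA.eigenvalues
  unfold eigsDesc at hlt
  set σ := Tuple.sort hA.eigenvalues with hσ
  obtain ⟨m, rfl⟩ := σ.surjective j
  have hm : m < i.rev := by
    by_contra! h
    exact absurd (hmono h) (not_le.2 hlt)
  have hcard : ((Finset.Ici m).map σ.toEmbedding).card ≤
      (Finset.univ.filter fun l => hA.eigenvalues l ≠ 0).card := by
    apply Finset.card_le_card
    intro l hl
    simp only [Finset.mem_map, Finset.mem_Ici] at hl
    obtain ⟨q, hq, rfl⟩ := hl
    simp only [Finset.mem_filter, Finset.mem_univ, true_and]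
    exact (lt_of_lt_of_le hpos (hmono hq)).ne'
  rw [hA.rank_eq_card_non_zero_eigs, Fintype.card_subtype] at hi
  rw [Finset.card_map, Fin.card_Ici, ← hi] at hcard
  have h1 : (m : ℕ) < n - (i + 1) := by
    have := Fin.lt_def.1 hm
    rwa [Fin.val_rev] at this
  omega

/-- Spectral facts: a symmetric generalized inverse, and `A² - λ A` is positive semidefinite. -/
theorem aux_spec {n : ℕ} {A : Matrix (Fin n) (Fin n) ℝ} (hA : A.IsHermitian)
    (l : ℝ) (hnn : ∀ j, 0 ≤ hA.eigenvalues j)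
    (hl : ∀ j, hA.eigenvalues j ≠ 0 → l ≤ hA.eigenvalues j) :
    (∃ B : Matrix (Fin n) (Fin n) ℝ, A * B * A = A) ∧ (A * A - l • A).PosSemidef := by
  set a := hA.eigenvalues with ha
  set U : Matrix (Fin n) (Fin n) ℝ := (hA.eigenvectorUnitary : Matrix (Fin n) (Fin n) ℝ) with hU
  have hUU : Uᴴ * U = 1 := by
    have := Unitary.coe_star_mul_self hA.eigenvectorUnitary
    exact this
  have hs : A = U * diagonal a * Uᴴ := by
    have := hA.spectral_theorem
    rw [Unitary.conjStarAlgAut_apply] at this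
    exact this
  have key : ∀ D E : Matrix (Fin n) (Fin n) ℝ,
      (U * D * Uᴴ) * (U * E * Uᴴ) = U * (D * E) * Uᴴ := by
    intro D E
    calc _ = U * D * (Uᴴ * U) * E * Uᴴ := by simp only [Matrix.mul_assoc]
      _ = _ := by rw [hUU]; simp only [Matrix.mul_assoc, Matrix.mul_one]
  clear_value a U
  constructor
  · refine ⟨U * diagonal (fun j => (a j)⁻¹) * Uᴴ, ?_⟩
    rw [hs, key, key, diagonal_mul_diagonal, diagonal_mul_diagonal]
    congr 3
    ext j
    by_cases h : a j = 0
    · simp [h]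
    · field_simp
  · have : A * A - l • A = U * diagonal (fun j => a j * a j - l * a j) * Uᴴ := by
      rw [hs, key, diagonal_mul_diagonal, ← Matrix.smul_mul, ← Matrix.mul_smul,
        ← Matrix.sub_mul, ← Matrix.mul_sub, ← diagonal_smul, ← diagonal_sub]
      rfl
    rw [this]
    apply Matrix.PosSemidef.mul_mul_conjTranspose_same
    rw [Matrix.posSemidef_diagonal_iff]
    intro j
    by_cases h : a j = 0
    · simp [h]
    · nlinarith [hnn j, hl j h]

/-- Lemma 13, basis scaling.  `J(Y) = XYᵀ + YXᵀ` and
`Y⋆ = J†(H)` is encoded by its characterization as the minimum-Frobenius-norm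
least-squares solution: `Y⋆` minimizes the residual `‖J(Y) − H‖_F` (hypothesis
`hls`), and among all residual minimizers it has minimal Frobenius norm
(hypothesis `hmn`).  With `k = rank X` and `i + 1 = k`,
`‖X Y⋆ᵀ + Y⋆ Xᵀ‖_F² ≥ 2 λ_k(XXᵀ) ‖Y⋆‖_F²`. -/
theorem basis_scaling
    {n r : ℕ}
    (H : Matrix (Fin n) (Fin n) ℝ) (X : Matrix (Fin n) (Fin r) ℝ)
    (hXX : (X * Xᵀ).IsHermitian)
    (i : Fin n) (hi : (i : ℕ) + 1 = X.rank)
    (Ystar : Matrix (Fin n) (Fin r) ℝ)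
    (hls : ∀ Y : Matrix (Fin n) (Fin r) ℝ,
      frobNorm (X * Ystarᵀ + Ystar * Xᵀ - H) ≤ frobNorm (X * Yᵀ + Y * Xᵀ - H))
    (hmn : ∀ Y : Matrix (Fin n) (Fin r) ℝ,
      frobNorm (X * Yᵀ + Y * Xᵀ - H) ≤ frobNorm (X * Ystarᵀ + Ystar * Xᵀ - H) →
        frobNorm Ystar ≤ frobNorm Y) :
    2 * eigsDesc hXX i * (frobNorm Ystar) ^ 2 ≤
      (frobNorm (X * Ystarᵀ + Ystar * Xᵀ)) ^ 2 := by
  set Y := Ystar with hY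
  have hYr : X.rank = (X * Xᵀ).rank := (Matrix.rank_self_mul_transpose X).symm
  have hpsd : (X * Xᵀ).PosSemidef := by
    have := Matrix.posSemidef_self_mul_conjTranspose X
    rwa [Matrix.conjTranspose_eq_transpose_of_trivial] at this
  obtain ⟨⟨B, hB⟩, hM⟩ := aux_spec hXX (eigsDesc hXX i) hpsd.eigenvalues_nonneg
    (aux_eig hXX hpsd i (hi.trans hYr))
  generalize eigsDesc hXX i = l at hM ⊢
  -- orthogonality to the kernel
  have horth : ∀ Z : Matrix (Fin n) (Fin r) ℝ, X * Zᵀ + Z * Xᵀ = 0 → trace (Y * Zᵀ) = 0 := by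
    intro Z hZ
    have hq : ∀ t : ℝ, 0 ≤ trace (Z * Zᵀ) * (t * t) + (2 * trace (Y * Zᵀ)) * t + 0 := by
      intro t
      have h1 : X * (Y + t • Z)ᵀ + (Y + t • Z) * Xᵀ = X * Yᵀ + Y * Xᵀ := by
        have : X * (Y + t • Z)ᵀ + (Y + t • Z) * Xᵀ
            = X * Yᵀ + Y * Xᵀ + t • (X * Zᵀ + Z * Xᵀ) := by
          simp only [transpose_add, transpose_smul, Matrix.mul_add, Matrix.add_mul,
            Matrix.mul_smul, Matrix.smul_mul, smul_add]
          abel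
        rw [this, hZ]; simp
      have h2 := hmn (Y + t • Z) (by rw [h1])
      have h3 : frobNorm Y ^ 2 ≤ frobNorm (Y + t • Z) ^ 2 :=
        pow_le_pow_left₀ (Real.sqrt_nonneg _) h2 2
      rw [aux_fsq, aux_fsq] at h3
      have h4 : trace (Z * Yᵀ) = trace (Y * Zᵀ) := by
        rw [← trace_transpose, transpose_mul, transpose_transpose]
      simp only [transpose_add, transpose_smul, Matrix.mul_add, Matrix.add_mul,
            Matrix.mul_smul, Matrix.smul_mul, trace_add, trace_smul, smul_eq_mul, h4] at h3
      linarith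
    have := discrim_le_zero hq
    unfold discrim at this
    nlinarith [sq_nonneg (trace (Y * Zᵀ))]
  -- row space
  have hW : ∃ W : Matrix (Fin n) (Fin n) ℝ, Y = W * X := by
    have hXB : X * Xᵀ * B * X = X := by
      have : X * Xᵀ * B * X - X = 0 := by
        apply aux_tr_zero
        have : (X * Xᵀ * B * X - X) * (X * Xᵀ * B * X - X)ᵀ
            = (X * Xᵀ * B * (X * Xᵀ) - X * Xᵀ) * (X * Xᵀ * B - 1)ᵀ := by
          have e : X * Xᵀ * B * X - X = (X * Xᵀ * B - 1) * X := by
            rw [Matrix.sub_mul, Matrix.one_mul]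
          have e2 : X * Xᵀ * B * (X * Xᵀ) - X * Xᵀ = (X * Xᵀ * B - 1) * (X * Xᵀ) := by
            rw [Matrix.sub_mul, Matrix.one_mul]
          rw [e, e2, transpose_mul]
          simp only [Matrix.mul_assoc]
        rw [this, hB]; simp
      exact sub_eq_zero.1 this
    have hXBt : Xᵀ * Bᵀ * X * Xᵀ = Xᵀ := by
      have := congrArg transpose hXB
      simp only [transpose_mul, transpose_transpose] at this
      simpa only [Matrix.mul_assoc] using this
    refine ⟨Y * Xᵀ * Bᵀ, ?_⟩
    set Z := Y - Y * Xᵀ * Bᵀ * X with hZ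
    have hZX : Z * Xᵀ = 0 := by
      have : Z * Xᵀ = Y * Xᵀ - Y * (Xᵀ * Bᵀ * X * Xᵀ) := by
        rw [hZ, Matrix.sub_mul]; simp only [Matrix.mul_assoc]
      rw [this, hXBt, sub_self]
    have hXZ : X * Zᵀ = 0 := by
      have := congrArg transpose hZX
      simpa only [transpose_mul, transpose_transpose, transpose_zero] using this
    have h0 := horth Z (by rw [hZX, hXZ, add_zero])
    have : Z = 0 := by
      apply aux_tr_zero
      have e : Z * Zᵀ = Y * Zᵀ - Y * Xᵀ * Bᵀ * (X * Zᵀ) := by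
        conv_lhs => rw [hZ, Matrix.sub_mul, ← hZ]
        simp only [Matrix.mul_assoc]
      rw [e, hXZ, trace_sub, h0]; simp
    exact sub_eq_zero.1 this
  -- skew directions
  have hG : 0 ≤ trace (X * Yᵀ * (X * Yᵀ)) := by
    have h0 := horth (X * (Xᵀ * Y - Yᵀ * X)) (by
      simp only [transpose_mul, transpose_sub, transpose_transpose, Matrix.mul_sub,
        Matrix.sub_mul, Matrix.mul_assoc]
      abel)
    have h1 : trace (Y * (X * (Xᵀ * Y - Yᵀ * X))ᵀ)
        = trace (Yᵀ * X * (Yᵀ * X)ᵀ) - trace (X * Yᵀ * (X * Yᵀ)) := by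
      simp only [transpose_mul, transpose_sub, transpose_transpose, Matrix.mul_sub,
        trace_sub]
      congr 1
      · rw [trace_mul_comm Y, trace_mul_comm (Yᵀ * X)]
        rw [trace_mul_comm (Xᵀ * Y)]
        simp only [Matrix.mul_assoc]
      · rw [← trace_transpose (X * Yᵀ * (X * Yᵀ))]
        simp only [transpose_mul, transpose_transpose, Matrix.mul_assoc]
    have := aux_tr_nonneg (Yᵀ * X)
    linarith
  obtain ⟨W, hW⟩ := hW
  have hfin := (hM.mul_mul_conjTranspose_same W).trace_nonneg
  rw [Matrix.conjTranspose_eq_transpose_of_trivial, Matrix.mul_sub, Matrix.sub_mul, trace_sub,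
    Matrix.mul_smul, Matrix.smul_mul, trace_smul, smul_eq_mul] at hfin
  have e1 : W * (X * Xᵀ) * Wᵀ = Y * Yᵀ := by
    rw [hW, transpose_mul]; simp only [Matrix.mul_assoc]
  have e2 : W * (X * Xᵀ * (X * Xᵀ)) * Wᵀ = Y * Xᵀ * (X * Yᵀ) := by
    rw [hW, transpose_mul]; simp only [Matrix.mul_assoc]
  rw [e1, e2] at hfin
  rw [aux_fsq, aux_fsq]
  simp only [transpose_add, transpose_mul, transpose_transpose, Matrix.mul_add, Matrix.add_mul,
    trace_add]
  have e3 : trace (X * Yᵀ * (Y * Xᵀ)) = trace (Y * Xᵀ * (X * Yᵀ)) := trace_mul_comm _ _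
  have e4 : trace (Y * Xᵀ * (Y * Xᵀ)) = trace (X * Yᵀ * (X * Yᵀ)) := by
    rw [← trace_transpose]
    simp only [transpose_mul, transpose_transpose]
  linarith
end
end

section
/- Let φ: ℝ^{n×n} → ℝ be L-gradient Lipschitz and (μ,2r)-restricted strongly convex, and let the global minimizer M⋆ = argmin φ satisfy M⋆ ⪰ 0 and r⋆ = rank(M⋆) ≤ r. Define f(X) = φ(XXᵀ) and let X⋆ be a global minimizer of f. If X ∈ ℝ^{n×r} satisfies f(X) − f(X⋆) ≤ (μ/(2(1+L/μ)))·λ_{r⋆}(M⋆)², then λ_{r⋆}(XXᵀ) ≥ (√(1+L/μ) − 1)·‖XXᵀ − M⋆‖_F. -/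
open Matrix

noncomputable section

lemma aux_rank {n r : ℕ} (Y X : Matrix (Fin n) (Fin r) ℝ) (a b : ℝ) :
    (a • (Y * Yᵀ) + b • (X * Xᵀ)).rank ≤ 2 * r := by
  have h : a • (Y * Yᵀ) + b • (X * Xᵀ)
      = Matrix.fromCols Y X * Matrix.fromRows (a • Yᵀ) (b • Xᵀ) := by
    rw [Matrix.fromCols_mul_fromRows]
    simp
  rw [h]
  refine (Matrix.rank_mul_le_left _ _).trans ((Matrix.rank_le_card_width _).trans ?_)
  simp [two_mul]

/-- spectral decomposition, entrywise -/
lemma aux_spectral {n : ℕ} {A : Matrix (Fin n) (Fin n) ℝ} (hA : A.IsHermitian) :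
    ∃ U : Matrix (Fin n) (Fin n) ℝ, U * Uᵀ = 1 ∧
      A = U * Matrix.diagonal hA.eigenvalues * Uᵀ := by
  refine ⟨hA.eigenvectorUnitary, ?_, ?_⟩
  · have := Unitary.coe_mul_star_self hA.eigenvectorUnitary
    simpa [Matrix.star_eq_conjTranspose, Matrix.conjTranspose_eq_transpose_of_trivial] using this
  · have := hA.spectral_theorem
    rw [Unitary.conjStarAlgAut_apply] at this
    simpa [Matrix.star_eq_conjTranspose, Matrix.conjTranspose_eq_transpose_of_trivial,
      Function.comp_def] using this

lemma aux_factor_s14 {n r : ℕ} {A : Matrix (Fin n) (Fin n) ℝ} (hA : A.PosSemidef)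
    (hr : A.rank ≤ r) : ∃ Y : Matrix (Fin n) (Fin r) ℝ, A = Y * Yᵀ := by
  obtain ⟨U, -, hU⟩ := aux_spectral hA.isHermitian
  have hnn := hA.eigenvalues_nonneg
  have hc := hA.isHermitian.rank_eq_card_non_zero_eigs
  generalize hA.isHermitian.eigenvalues = d at *
  obtain ⟨e⟩ := Function.Embedding.nonempty_of_card_le
    (α := {i // d i ≠ 0}) (β := Fin r) (by simpa [← hc] using hr)
  let P : Matrix (Fin n) (Fin r) ℝ := fun k c =>
    if h : d k ≠ 0 then (if e ⟨k, h⟩ = c then Real.sqrt (d k) else 0) else 0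
  have hP : P * Pᵀ = Matrix.diagonal d := by
    ext k l
    rw [Matrix.mul_apply]
    have hPT : ∀ a b, Pᵀ a b = P b a := fun _ _ => rfl
    simp only [hPT]
    simp only [P]
    by_cases hk : d k = 0
    · by_cases hkl : k = l
      · subst hkl; simp [hk]
      · simp [hk, Matrix.diagonal_apply_ne _ hkl]
    · by_cases hkl : k = l
      · subst hkl; simp [hk, Real.mul_self_sqrt (hnn k)]
      · by_cases hl : d l = 0
        · simp [hl, Matrix.diagonal_apply_ne _ hkl]
        · simp [hk, hl, Matrix.diagonal_apply_ne _ hkl]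
          intro h
          exact absurd h hkl
  refine ⟨U * P, ?_⟩
  rw [Matrix.transpose_mul, hU, ← hP]
  simp only [Matrix.mul_assoc]

lemma aux_quad {n : ℕ} (U : Matrix (Fin n) (Fin n) ℝ) (d x : Fin n → ℝ) :
    x ⬝ᵥ ((U * Matrix.diagonal d * Uᵀ) *ᵥ x) = ∑ k, d k * ((Uᵀ *ᵥ x) k) ^ 2 := by
  rw [← Matrix.mulVec_mulVec, ← Matrix.mulVec_mulVec, Matrix.dotProduct_mulVec,
    ← Matrix.mulVec_transpose, dotProduct]
  refine Finset.sum_congr rfl fun k _ => ?_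
  rw [Matrix.mulVec_diagonal]
  ring

lemma aux_quad_one {n : ℕ} (U : Matrix (Fin n) (Fin n) ℝ) (hU : U * Uᵀ = 1) (x : Fin n → ℝ) :
    x ⬝ᵥ x = ∑ k, ((Uᵀ *ᵥ x) k) ^ 2 := by
  have := aux_quad U (fun _ => 1) x
  simpa [hU] using this

lemma aux_frob {n : ℕ} (E : Matrix (Fin n) (Fin n) ℝ) (x : Fin n → ℝ) :
    x ⬝ᵥ (E *ᵥ x) ≤ frobNorm E * (x ⬝ᵥ x) := by
  have h1 : x ⬝ᵥ (E *ᵥ x) = ∑ p : Fin n × Fin n, E p.1 p.2 * (x p.1 * x p.2) := by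
    rw [Fintype.sum_prod_type]
    simp only [dotProduct, Matrix.mulVec, Finset.mul_sum]
    refine Finset.sum_congr rfl fun a _ => Finset.sum_congr rfl fun b _ => by ring
  have h2 : (x ⬝ᵥ x) ^ 2 = ∑ p : Fin n × Fin n, (x p.1 * x p.2) ^ 2 := by
    rw [Fintype.sum_prod_type, sq]
    simp only [dotProduct, Finset.sum_mul_sum]
    refine Finset.sum_congr rfl fun a _ => Finset.sum_congr rfl fun b _ => by ring
  have h3 : frobNorm E ^ 2 = ∑ p : Fin n × Fin n, (E p.1 p.2) ^ 2 := by
    rw [Fintype.sum_prod_type, frobNorm, Real.sq_sqrt (by positivity)]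
  have h4 := Finset.sum_mul_sq_le_sq_mul_sq Finset.univ
    (fun p : Fin n × Fin n => E p.1 p.2) (fun p => x p.1 * x p.2)
  rw [← h1, ← h2, ← h3, ← mul_pow] at h4
  have h5 : 0 ≤ x ⬝ᵥ x := by
    rw [dotProduct]; exact Finset.sum_nonneg fun a _ => mul_self_nonneg _
  exact (le_abs_self _).trans (abs_le_of_sq_le_sq h4 (mul_nonneg (Real.sqrt_nonneg _) h5))

lemma frobNorm_neg' {n : ℕ} (A B : Matrix (Fin n) (Fin n) ℝ) :
    frobNorm (A - B) = frobNorm (B - A) := by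
  unfold frobNorm
  congr 1
  refine Finset.sum_congr rfl fun a _ => Finset.sum_congr rfl fun b _ => ?_
  simp only [Matrix.sub_apply]; ring

lemma aux_weyl {n : ℕ} {A B : Matrix (Fin n) (Fin n) ℝ} (hA : A.IsHermitian)
    (hB : B.IsHermitian) (i : Fin n) :
    eigsDesc hB i ≤ eigsDesc hA i + frobNorm (A - B) := by
  obtain ⟨U, hU1, hU⟩ := aux_spectral hA
  obtain ⟨V, hV1, hV⟩ := aux_spectral hB
  unfold eigsDesc
  generalize i.rev = p
  have mA := Tuple.monotone_sort hA.eigenvalues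
  have mB := Tuple.monotone_sort hB.eigenvalues
  generalize Tuple.sort hA.eigenvalues = σ at *
  generalize Tuple.sort hB.eigenvalues = τ at *
  generalize hA.eigenvalues = a at *
  generalize hB.eigenvalues = b at *
  let G : Matrix (Fin n) (Fin n) ℝ := fun k =>
    if k < p then Vᵀ (τ k) else if p < k then Uᵀ (σ k) else 0
  have hG : G.det = 0 := Matrix.det_eq_zero_of_row_eq_zero p (fun j => by simp [G])
  obtain ⟨x, hx0, hx⟩ := Matrix.exists_mulVec_eq_zero_iff.2 hG
  have hBx : ∀ k, k < p → (Vᵀ *ᵥ x) (τ k) = 0 := by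
    intro k hk
    have := congrFun hx k
    simpa [Matrix.mulVec, G, hk] using this
  have hAx : ∀ k, p < k → (Uᵀ *ᵥ x) (σ k) = 0 := by
    intro k hk
    have := congrFun hx k
    simpa [Matrix.mulVec, G, hk, not_lt.2 hk.le] using this
  have hpos : 0 < x ⬝ᵥ x := by
    have h5 : 0 ≤ x ⬝ᵥ x := by
      rw [dotProduct]; exact Finset.sum_nonneg fun a _ => mul_self_nonneg _
    exact lt_of_le_of_ne h5 fun h => hx0 (dotProduct_self_eq_zero.1 h.symm)
  have e1 : x ⬝ᵥ (A *ᵥ x) ≤ a (σ p) * (x ⬝ᵥ x) := by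
    rw [aux_quad_one U hU1 x, hU, aux_quad, Finset.mul_sum,
      ← Equiv.sum_comp σ (fun k => a k * (Uᵀ *ᵥ x) k ^ 2),
      ← Equiv.sum_comp σ (fun k => a (σ p) * (Uᵀ *ᵥ x) k ^ 2)]
    refine Finset.sum_le_sum fun k _ => ?_
    rcases lt_or_ge p k with hk | hk
    · rw [hAx k hk]; simp
    · exact mul_le_mul_of_nonneg_right (mA hk) (sq_nonneg _)
  have e2 : b (τ p) * (x ⬝ᵥ x) ≤ x ⬝ᵥ (B *ᵥ x) := by
    rw [aux_quad_one V hV1 x, hV, aux_quad, Finset.mul_sum,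
      ← Equiv.sum_comp τ (fun k => b k * (Vᵀ *ᵥ x) k ^ 2),
      ← Equiv.sum_comp τ (fun k => b (τ p) * (Vᵀ *ᵥ x) k ^ 2)]
    refine Finset.sum_le_sum fun k _ => ?_
    rcases lt_or_ge k p with hk | hk
    · rw [hBx k hk]; simp
    · exact mul_le_mul_of_nonneg_right (mB hk) (sq_nonneg _)
  have e3 := aux_frob (B - A) x
  rw [Matrix.sub_mulVec, dotProduct_sub, frobNorm_neg'] at e3
  refine le_of_mul_le_mul_right ?_ hpos
  linarith

lemma aux_convex {n r : ℕ}
    (φ : Matrix (Fin n) (Fin n) ℝ → ℝ)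
    (gradφ : Matrix (Fin n) (Fin n) ℝ → Matrix (Fin n) (Fin n) ℝ)
    (hessφ : Matrix (Fin n) (Fin n) ℝ → Matrix (Fin n) (Fin n) ℝ → Matrix (Fin n) (Fin n) ℝ)
    (μ : ℝ)
    (hgrad : IsGradientOf φ gradφ)
    (hhess : IsHessianOf gradφ hessφ)
    (hRSC : RestrictedStronglyConvex hessφ μ (2 * r))
    (Y X : Matrix (Fin n) (Fin r) ℝ)
    (hmin : ∀ M : Matrix (Fin n) (Fin n) ℝ, φ (Y * Yᵀ) ≤ φ M) :
    μ / 2 * frobNorm (X * Xᵀ - Y * Yᵀ) ^ 2 ≤ φ (X * Xᵀ) - φ (Y * Yᵀ) := by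
  set M := Y * Yᵀ with hM
  set E := X * Xᵀ - M with hE
  set c := μ * frobNorm E ^ 2 with hc
  have shift : ∀ t s : ℝ, M + t • E + (s - t) • E = M + s • E := by
    intro t s
    rw [add_assoc, ← add_smul]; congr 2; ring
  have g1 : ∀ t : ℝ, HasDerivAt (fun t : ℝ => φ (M + t • E)) (minner (gradφ (M + t • E)) E) t := by
    intro t
    have h := hgrad (M + t • E) E
    have h' := HasDerivAt.comp_sub_const t t (by simpa using h)
    simpa only [shift] using h'
  have g2 : ∀ t : ℝ, HasDerivAt (fun t : ℝ => minner (gradφ (M + t • E)) E)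
      (minner (hessφ (M + t • E) E) E) t := by
    intro t
    have h := hhess (M + t • E) E E
    have h' := HasDerivAt.comp_sub_const t t (by simpa using h)
    simpa only [shift] using h'
  have g3 : ∀ t : ℝ, c ≤ minner (hessφ (M + t • E) E) E := by
    intro t
    refine hRSC _ _ ?_ ?_
    · have : M + t • E = (1 - t) • (Y * Yᵀ) + t • (X * Xᵀ) := by
        rw [hE, hM]; module
      rw [this]; exact aux_rank _ _ _ _
    · have : E = (-1 : ℝ) • (Y * Yᵀ) + (1 : ℝ) • (X * Xᵀ) := by
        rw [hE, hM]; module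
      rw [this]; exact aux_rank _ _ _ _
  have g0 : minner (gradφ (M + (0 : ℝ) • E)) E = 0 := by
    refine IsLocalMin.hasDerivAt_eq_zero (Filter.Eventually.of_forall fun t => ?_) (g1 0)
    simpa using hmin (M + t • E)
  have hd : ∀ t : ℝ, HasDerivAt (fun t : ℝ => minner (gradφ (M + t • E)) E - c * t)
      (minner (hessφ (M + t • E) E) E - c) t := by
    intro t
    refine ((g2 t).sub ((hasDerivAt_id t).const_mul c)).congr_deriv ?_
    simp
  have hm : Monotone (fun t : ℝ => minner (gradφ (M + t • E)) E - c * t) := by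
    refine monotone_of_deriv_nonneg (fun t => (hd t).differentiableAt) fun t => ?_
    rw [(hd t).deriv]; linarith [g3 t]
  have kd : ∀ t : ℝ, HasDerivAt (fun t : ℝ => φ (M + t • E) - c / 2 * t ^ 2)
      (minner (gradφ (M + t • E)) E - c * t) t := by
    intro t
    have h := (g1 t).sub ((hasDerivAt_pow 2 t).const_mul (c / 2))
    refine h.congr_deriv ?_
    simp; ring
  have km : MonotoneOn (fun t : ℝ => φ (M + t • E) - c / 2 * t ^ 2) (Set.Ici 0) := by
    refine monotoneOn_of_deriv_nonneg (convex_Ici 0)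
      (fun t _ => (kd t).continuousAt.continuousWithinAt)
      (fun t _ => (kd t).differentiableAt.differentiableWithinAt) fun t ht => ?_
    rw [interior_Ici] at ht
    rw [(kd t).deriv]
    have := hm (le_of_lt ht : (0 : ℝ) ≤ t)
    simp only [g0] at this
    linarith
  have hfin := km (Set.mem_Ici.2 le_rfl) (Set.mem_Ici.2 zero_le_one) zero_le_one
  have hX : M + E = X * Xᵀ := by rw [hE]; abel
  simp [hX] at hfin
  linarith

/-- Lemma 18, base case.  With `f X = φ (X Xᵀ)`,
`λ_{r⋆}(M⋆) = eigsDesc hpsd.isHermitian i` and `λ_{r⋆}(XXᵀ) = eigsDesc hXX j`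
for `i, j` with `i + 1 = j + 1 = r⋆`:
if `f(X) − f(X⋆) ≤ (μ/(2(1+L/μ))) λ_{r⋆}(M⋆)²` then
`λ_{r⋆}(XXᵀ) ≥ (√(1+L/μ) − 1) ‖XXᵀ − M⋆‖_F`. -/
theorem base_case
    {n r rstar : ℕ}
    (φ : Matrix (Fin n) (Fin n) ℝ → ℝ)
    (gradφ : Matrix (Fin n) (Fin n) ℝ → Matrix (Fin n) (Fin n) ℝ)
    (hessφ : Matrix (Fin n) (Fin n) ℝ → Matrix (Fin n) (Fin n) ℝ → Matrix (Fin n) (Fin n) ℝ)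
    (L μ : ℝ) (hL : 0 < L) (hμ : 0 < μ)
    (hgrad : IsGradientOf φ gradφ)
    (hhess : IsHessianOf gradφ hessφ)
    (hLip : GradLipschitz gradφ L)
    (hRSC : RestrictedStronglyConvex hessφ μ (2 * r))
    (Mstar : Matrix (Fin n) (Fin n) ℝ)
    (hmin : ∀ M : Matrix (Fin n) (Fin n) ℝ, φ Mstar ≤ φ M)
    (hpsd : Mstar.PosSemidef)
    (hrank : Mstar.rank = rstar) (hrr : rstar ≤ r)
    (i : Fin n) (hi : (i : ℕ) + 1 = rstar)
    (Xstar : Matrix (Fin n) (Fin r) ℝ)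
    (hfmin : ∀ Y : Matrix (Fin n) (Fin r) ℝ, φ (Xstar * Xstarᵀ) ≤ φ (Y * Yᵀ))
    (X : Matrix (Fin n) (Fin r) ℝ)
    (hXX : (X * Xᵀ).IsHermitian)
    (j : Fin n) (hj : (j : ℕ) + 1 = rstar)
    (hclose : φ (X * Xᵀ) - φ (Xstar * Xstarᵀ) ≤
      μ / (2 * (1 + L / μ)) * (eigsDesc hpsd.isHermitian i) ^ 2) :
    (Real.sqrt (1 + L / μ) - 1) * frobNorm (X * Xᵀ - Mstar) ≤ eigsDesc hXX j := by
  obtain rfl : i = j := Fin.ext (by omega)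
  obtain ⟨Y, hY⟩ := aux_factor_s14 hpsd (hrank.trans_le hrr)
  have h1 : μ / 2 * frobNorm (X * Xᵀ - Mstar) ^ 2 ≤ φ (X * Xᵀ) - φ Mstar := by
    have := aux_convex φ gradφ hessφ μ hgrad hhess hRSC Y X (by rw [← hY]; exact hmin)
    rwa [← hY] at this
  have h2 : φ (Xstar * Xstarᵀ) ≤ φ Mstar := by
    have := hfmin Y
    rwa [← hY] at this
  have h3 := aux_weyl hXX hpsd.isHermitian i
  have h4 : 0 ≤ eigsDesc hpsd.isHermitian i := hpsd.eigenvalues_nonneg _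
  generalize eigsDesc hpsd.isHermitian i = l at *
  have h5 : 0 ≤ frobNorm (X * Xᵀ - Mstar) := Real.sqrt_nonneg _
  generalize frobNorm (X * Xᵀ - Mstar) = e at *
  have hk : 0 < 1 + L / μ := by positivity
  generalize 1 + L / μ = κ at *
  have h6 : μ / 2 * e ^ 2 ≤ μ / (2 * κ) * l ^ 2 := by linarith
  have h7 : (Real.sqrt κ * e) ^ 2 ≤ l ^ 2 := by
    rw [mul_pow, Real.sq_sqrt hk.le]
    have h8 : μ / (2 * κ) * l ^ 2 = μ / 2 * (l ^ 2 / κ) := by field_simp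
    rw [h8] at h6
    have h9 := le_of_mul_le_mul_left h6 (by positivity)
    rw [le_div_iff₀ hk] at h9
    linarith
  have h10 : Real.sqrt κ * e ≤ l := (le_abs_self _).trans (abs_le_of_sq_le_sq h7 h4)
  linarith
end
end

section
/- Let n, r, r⋆, k be positive integers with r⋆ ≤ k ≤ min(n, r), let X₁ ∈ ℝ^{k×k} and X₂ ∈ ℝ^{(n−k)×(r−k)} satisfy σ_min(X₁) ≥ σ_max(X₂), and set X = [[X₁, 0], [0, X₂]] ∈ ℝ^{n×r}. Let Z₁ ∈ ℝ^{k×r⋆}, Z₂ ∈ ℝ^{(n−k)×r⋆}, and Z = [Z₁; Z₂] ∈ ℝ^{n×r⋆} with λ_min(ZᵀZ) > 0. If ρ = ‖XXᵀ − ZZᵀ‖_F / λ_min(ZᵀZ) < 1/√2, then λ_min(Z₁ᵀZ₁) ≥ λ_max(Z₂ᵀZ₂). -/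
open Matrix

noncomputable section

lemma cs_dot {m : Type*} [Fintype m] (u v : m → ℝ) :
    (u ⬝ᵥ v) ^ 2 ≤ (u ⬝ᵥ u) * (v ⬝ᵥ v) := by
  have h := Finset.sum_mul_sq_le_sq_mul_sq Finset.univ u v
  simpa [dotProduct, sq] using h

lemma dot_self_nn {m : Type*} [Fintype m] (u : m → ℝ) : 0 ≤ u ⬝ᵥ u :=
  Finset.sum_nonneg fun i _ => mul_self_nonneg (u i)

/-- squared Frobenius norm -/
def fsq {m r : Type*} [Fintype m] [Fintype r] (A : Matrix m r ℝ) : ℝ :=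
  ∑ i, ∑ j, (A i j) ^ 2

lemma fsq_nn {m r : Type*} [Fintype m] [Fintype r] (A : Matrix m r ℝ) : 0 ≤ fsq A :=
  Finset.sum_nonneg fun _ _ => Finset.sum_nonneg fun _ _ => sq_nonneg _

lemma mulVec_fsq {m r : Type*} [Fintype m] [Fintype r] (A : Matrix m r ℝ) (v : r → ℝ) :
    (A *ᵥ v) ⬝ᵥ (A *ᵥ v) ≤ fsq A * (v ⬝ᵥ v) := by
  unfold fsq
  rw [Finset.sum_mul]
  refine Finset.sum_le_sum fun i _ => ?_
  have h := cs_dot (A i) v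
  have e : A i ⬝ᵥ A i = ∑ j, (A i j) ^ 2 := by simp [dotProduct, sq]
  rw [e] at h
  calc (A *ᵥ v) i * (A *ᵥ v) i = (A i ⬝ᵥ v) ^ 2 := by rw [sq]; rfl
    _ ≤ _ := h

lemma quad_le {m : Type*} [Fintype m] (D : Matrix m m ℝ) (w : m → ℝ) :
    |w ⬝ᵥ (D *ᵥ w)| ≤ Real.sqrt (fsq D) * (w ⬝ᵥ w) := by
  have hw := dot_self_nn w
  apply abs_le_of_sq_le_sq _ (mul_nonneg (Real.sqrt_nonneg _) hw)
  rw [mul_pow, Real.sq_sqrt (fsq_nn D)]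
  calc _ ≤ (w ⬝ᵥ w) * ((D *ᵥ w) ⬝ᵥ (D *ᵥ w)) := cs_dot _ _
    _ ≤ (w ⬝ᵥ w) * (fsq D * (w ⬝ᵥ w)) := mul_le_mul_of_nonneg_left (mulVec_fsq D w) hw
    _ = _ := by ring

lemma dot_gram {m r : Type*} [Fintype m] [Fintype r] (W : Matrix m r ℝ) (v : r → ℝ) :
    v ⬝ᵥ ((Wᵀ * W) *ᵥ v) = (W *ᵥ v) ⬝ᵥ (W *ᵥ v) := by
  rw [← Matrix.mulVec_mulVec, Matrix.dotProduct_mulVec, Matrix.vecMul_transpose]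

lemma rayleigh_eq {m : Type*} {r : ℕ} [Fintype m] (W : Matrix m (Fin r) ℝ) (v : Fin r → ℝ) :
    ∑ i, (Wᵀ * W).mulVec v i * v i = (W *ᵥ v) ⬝ᵥ (W *ᵥ v) := by
  rw [← dot_gram, dotProduct_comm]; rfl

lemma unit_eq {r : ℕ} (v : Fin r → ℝ) : ∑ i, (v i) ^ 2 = v ⬝ᵥ v := by
  simp [dotProduct, sq]

lemma nrmlz {r : ℕ} (v : Fin r → ℝ) (hv : 0 < v ⬝ᵥ v) :
    ∑ i, (((Real.sqrt (v ⬝ᵥ v))⁻¹ • v) i) ^ 2 = 1 := by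
  rw [unit_eq, smul_dotProduct, dotProduct_smul, smul_eq_mul, smul_eq_mul, ← mul_assoc,
    ← mul_inv, Real.mul_self_sqrt hv.le, inv_mul_cancel₀ hv.ne']

lemma nrmlz_val {m : Type*} {r : ℕ} [Fintype m] (W : Matrix m (Fin r) ℝ) (v : Fin r → ℝ)
    (hv : 0 < v ⬝ᵥ v) :
    (W *ᵥ ((Real.sqrt (v ⬝ᵥ v))⁻¹ • v)) ⬝ᵥ (W *ᵥ ((Real.sqrt (v ⬝ᵥ v))⁻¹ • v))
      = ((W *ᵥ v) ⬝ᵥ (W *ᵥ v)) / (v ⬝ᵥ v) := by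
  rw [Matrix.mulVec_smul, smul_dotProduct, dotProduct_smul, smul_eq_mul, smul_eq_mul, ← mul_assoc,
    ← mul_inv, Real.mul_self_sqrt hv.le]
  field_simp

lemma lamMin_mul_le {m : Type*} {r : ℕ} [Fintype m] (W : Matrix m (Fin r) ℝ) (v : Fin r → ℝ) :
    lamMin (Wᵀ * W) * (v ⬝ᵥ v) ≤ (W *ᵥ v) ⬝ᵥ (W *ᵥ v) := by
  rcases (dot_self_nn v).eq_or_lt with h | h
  · rw [← h, mul_zero]; exact dot_self_nn _
  · rw [← le_div_iff₀ h]
    refine csInf_le ⟨0, ?_⟩ ⟨_, nrmlz v h, ?_⟩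
    · rintro c ⟨w, -, rfl⟩
      rw [rayleigh_eq]; exact dot_self_nn _
    · rw [rayleigh_eq, nrmlz_val W v h]

lemma le_lamMax_mul {m : Type*} {r : ℕ} [Fintype m] (W : Matrix m (Fin r) ℝ) (v : Fin r → ℝ) :
    (W *ᵥ v) ⬝ᵥ (W *ᵥ v) ≤ lamMax (Wᵀ * W) * (v ⬝ᵥ v) := by
  rcases (dot_self_nn v).eq_or_lt with h | h
  · have := mulVec_fsq W v
    rw [← h, mul_zero] at this ⊢; exact this
  · rw [← div_le_iff₀ h]
    refine le_csSup ⟨fsq W, ?_⟩ ⟨_, nrmlz v h, ?_⟩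
    · rintro c ⟨w, hw, rfl⟩
      rw [rayleigh_eq]
      have := mulVec_fsq W w
      rwa [← unit_eq, hw, mul_one] at this
    · rw [rayleigh_eq, nrmlz_val W v h]

lemma exists_unit {r : ℕ} (hr : 1 ≤ r) : ∃ v : Fin r → ℝ, ∑ i, (v i) ^ 2 = 1 :=
  ⟨Pi.single ⟨0, hr⟩ 1, by simp [unit_eq]⟩

lemma le_lamMin {m : Type*} {r : ℕ} [Fintype m] (hr : 1 ≤ r) (W : Matrix m (Fin r) ℝ) (c : ℝ)
    (h : ∀ v, c * (v ⬝ᵥ v) ≤ (W *ᵥ v) ⬝ᵥ (W *ᵥ v)) : c ≤ lamMin (Wᵀ * W) := by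
  obtain ⟨v, hv⟩ := exists_unit hr
  refine le_csInf ⟨_, v, hv, rfl⟩ ?_
  rintro x ⟨w, hw, rfl⟩
  rw [rayleigh_eq]
  have := h w
  rwa [← unit_eq, hw, mul_one] at this

lemma lamMax_le {m : Type*} {r : ℕ} [Fintype m] (hr : 1 ≤ r) (W : Matrix m (Fin r) ℝ) (c : ℝ)
    (h : ∀ v, (W *ᵥ v) ⬝ᵥ (W *ᵥ v) ≤ c * (v ⬝ᵥ v)) : lamMax (Wᵀ * W) ≤ c := by
  obtain ⟨v, hv⟩ := exists_unit hr
  refine csSup_le ⟨_, v, hv, rfl⟩ ?_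
  rintro x ⟨w, hw, rfl⟩
  rw [rayleigh_eq]
  have := h w
  rwa [← unit_eq, hw, mul_one] at this

lemma lamMin_nn {m : Type*} {r : ℕ} [Fintype m] (W : Matrix m (Fin r) ℝ) :
    0 ≤ lamMin (Wᵀ * W) := by
  refine Real.sInf_nonneg ?_
  rintro x ⟨w, hw, rfl⟩
  rw [rayleigh_eq]; exact dot_self_nn _

lemma lamMax_nn {m : Type*} {r : ℕ} [Fintype m] (W : Matrix m (Fin r) ℝ) :
    0 ≤ lamMax (Wᵀ * W) := by
  refine Real.sSup_nonneg ?_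
  rintro x ⟨w, hw, rfl⟩
  rw [rayleigh_eq]; exact dot_self_nn _

lemma adj_dot {m r : Type*} [Fintype m] [Fintype r] (W : Matrix m r ℝ) (v : r → ℝ) (w : m → ℝ) :
    (Wᵀ *ᵥ w) ⬝ᵥ v = w ⬝ᵥ (W *ᵥ v) := by
  rw [Matrix.mulVec_transpose, Matrix.dotProduct_mulVec]

/-- upper bounds transfer to the transpose -/
lemma upper_transpose {m r : Type*} [Fintype m] [Fintype r] (W : Matrix m r ℝ) (c : ℝ) (hc : 0 ≤ c)
    (h : ∀ w, (Wᵀ *ᵥ w) ⬝ᵥ (Wᵀ *ᵥ w) ≤ c * (w ⬝ᵥ w)) (v : r → ℝ) :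
    (W *ᵥ v) ⬝ᵥ (W *ᵥ v) ≤ c * (v ⬝ᵥ v) := by
  set y := W *ᵥ v with hy
  have h1 : (y ⬝ᵥ y) ^ 2 ≤ (c * (y ⬝ᵥ y)) * (v ⬝ᵥ v) := by
    calc (y ⬝ᵥ y) ^ 2 = ((Wᵀ *ᵥ y) ⬝ᵥ v) ^ 2 := by rw [adj_dot]
      _ ≤ _ := cs_dot _ _
      _ ≤ _ := mul_le_mul_of_nonneg_right (h y) (dot_self_nn v)
  rcases (dot_self_nn y).eq_or_lt with h0 | h0
  · rw [← h0]; exact mul_nonneg hc (dot_self_nn v)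
  · nlinarith

/-- lower bounds transfer to the transpose when there are at least as many rows as columns -/
lemma lower_transpose {k r : ℕ} (hkr : r ≤ k) (W : Matrix (Fin k) (Fin r) ℝ) (c : ℝ) (hc : 0 < c)
    (h : ∀ w, c * (w ⬝ᵥ w) ≤ (Wᵀ *ᵥ w) ⬝ᵥ (Wᵀ *ᵥ w)) (v : Fin r → ℝ) :
    c * (v ⬝ᵥ v) ≤ (W *ᵥ v) ⬝ᵥ (W *ᵥ v) := by
  have hinj : Function.Injective (Wᵀ).mulVecLin := by
    rw [← LinearMap.ker_eq_bot, LinearMap.ker_eq_bot']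
    intro w hw
    have hw' : Wᵀ *ᵥ w = 0 := hw
    have := h w
    rw [hw'] at this
    have h4 := dot_self_nn w
    have h5 : w ⬝ᵥ w = 0 := by
      simp at this
      nlinarith
    exact dotProduct_self_eq_zero.mp h5
  have hle := LinearMap.finrank_le_finrank_of_injective hinj
  simp at hle
  have hsurj : Function.Surjective (Wᵀ).mulVecLin :=
    (LinearMap.injective_iff_surjective_of_finrank_eq_finrank (by simp; omega)).mp hinj
  obtain ⟨w, hw⟩ := hsurj v
  have hw' : Wᵀ *ᵥ w = v := hw
  have h1 : (v ⬝ᵥ v) ^ 2 ≤ (w ⬝ᵥ w) * ((W *ᵥ v) ⬝ᵥ (W *ᵥ v)) := by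
    calc (v ⬝ᵥ v) ^ 2 = (w ⬝ᵥ (W *ᵥ v)) ^ 2 := by rw [← adj_dot, hw']
      _ ≤ _ := cs_dot _ _
  have h2 := h w
  rw [hw'] at h2
  have h3 := dot_self_nn (W *ᵥ v)
  rcases (dot_self_nn v).eq_or_lt with h0 | h0
  · rw [← h0, mul_zero]; exact h3
  · have : (v ⬝ᵥ v) * (c * (v ⬝ᵥ v)) ≤ (v ⬝ᵥ v) * ((W *ᵥ v) ⬝ᵥ (W *ᵥ v)) := by nlinarith
    exact le_of_mul_le_mul_left this h0

lemma diff_quad {m r s : Type*} [Fintype m] [Fintype r] [Fintype s]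
    (P : Matrix m r ℝ) (Q : Matrix m s ℝ) (w : m → ℝ) :
    |(Pᵀ *ᵥ w) ⬝ᵥ (Pᵀ *ᵥ w) - (Qᵀ *ᵥ w) ⬝ᵥ (Qᵀ *ᵥ w)|
      ≤ Real.sqrt (fsq (P * Pᵀ - Q * Qᵀ)) * (w ⬝ᵥ w) := by
  have h := quad_le (P * Pᵀ - Q * Qᵀ) w
  have h1 := dot_gram Pᵀ w
  have h2 := dot_gram Qᵀ w
  rw [Matrix.transpose_transpose] at h1 h2
  rwa [Matrix.sub_mulVec, dotProduct_sub, h1, h2] at h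

lemma fsq_blocks {a b c d : Type*} [Fintype a] [Fintype b] [Fintype c] [Fintype d]
    (A : Matrix a c ℝ) (B : Matrix a d ℝ) (C : Matrix b c ℝ) (D : Matrix b d ℝ) :
    fsq (Matrix.fromBlocks A B C D) = fsq A + fsq B + fsq C + fsq D := by
  simp only [fsq, Fintype.sum_sum_type, Matrix.fromBlocks_apply₁₁, Matrix.fromBlocks_apply₁₂,
    Matrix.fromBlocks_apply₂₁, Matrix.fromBlocks_apply₂₂, Finset.sum_add_distrib]
  ring

lemma fsq_cross {m s : Type*} {r : ℕ} [Fintype m] [Fintype s]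
    (P : Matrix m (Fin r) ℝ) (Q : Matrix s (Fin r) ℝ) :
    lamMin (Pᵀ * P) * fsq Q ≤ fsq (P * Qᵀ) := by
  have e : fsq (P * Qᵀ) = ∑ j, (P *ᵥ Q j) ⬝ᵥ (P *ᵥ Q j) := by
    unfold fsq
    rw [Finset.sum_comm]
    refine Finset.sum_congr rfl fun j _ => Finset.sum_congr rfl fun i _ => ?_
    rw [sq]; rfl
  rw [e]
  unfold fsq
  rw [Finset.mul_sum]
  refine Finset.sum_le_sum fun j _ => ?_
  have := lamMin_mul_le P (Q j)
  simpa [dotProduct, sq] using this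

/-- Lemma 26 in the appendix.  `X` is the block-diagonal
matrix `[[X₁, 0], [0, X₂]]` and `Z = [Z₁; Z₂]` the vertical concatenation.  The
singular value condition `σ_min(X₁) ≥ σ_max(X₂)` is expressed as
`√λ_max(X₂ᵀX₂) ≤ √λ_min(X₁ᵀX₁)`.  If
`ρ = ‖XXᵀ − ZZᵀ‖_F / λ_min(ZᵀZ) < 1/√2` then
`λ_min(Z₁ᵀZ₁) ≥ λ_max(Z₂ᵀZ₂)`. -/
theorem block_eigenvalue_ordering
    {n r rstar k : ℕ}
    (hk : 1 ≤ k) (hrs1 : 1 ≤ rstar) (hn1 : 1 ≤ n) (hr1 : 1 ≤ r)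
    (hrsk : rstar ≤ k) (hkn : k ≤ n) (hkr : k ≤ r)
    (X₁ : Matrix (Fin k) (Fin k) ℝ) (X₂ : Matrix (Fin (n - k)) (Fin (r - k)) ℝ)
    (hσ : Real.sqrt (lamMax (X₂ᵀ * X₂)) ≤ Real.sqrt (lamMin (X₁ᵀ * X₁)))
    (Z₁ : Matrix (Fin k) (Fin rstar) ℝ) (Z₂ : Matrix (Fin (n - k)) (Fin rstar) ℝ)
    (hZpos : 0 < lamMin ((Matrix.fromRows Z₁ Z₂)ᵀ * Matrix.fromRows Z₁ Z₂))
    (hρ : frobNorm (Matrix.fromBlocks X₁ 0 0 X₂ * (Matrix.fromBlocks X₁ 0 0 X₂)ᵀ -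
          Matrix.fromRows Z₁ Z₂ * (Matrix.fromRows Z₁ Z₂)ᵀ) /
        lamMin ((Matrix.fromRows Z₁ Z₂)ᵀ * Matrix.fromRows Z₁ Z₂) <
      1 / Real.sqrt 2) :
    lamMax (Z₂ᵀ * Z₂) ≤ lamMin (Z₁ᵀ * Z₁) := by
  set α := lamMin (X₁ᵀ * X₁) with hα
  set β := lamMax (X₂ᵀ * X₂) with hβ
  set a := lamMin (Z₁ᵀ * Z₁) with ha
  set b := lamMax (Z₂ᵀ * Z₂) with hb
  set μ := lamMin ((Matrix.fromRows Z₁ Z₂)ᵀ * Matrix.fromRows Z₁ Z₂) with hμ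
  have hα0 : 0 ≤ α := lamMin_nn X₁
  have hβ0 : 0 ≤ β := lamMax_nn X₂
  have ha0 : 0 ≤ a := lamMin_nn Z₁
  have hb0 : 0 ≤ b := lamMax_nn Z₂
  have hβα : β ≤ α := (Real.sqrt_le_sqrt_iff hα0).mp hσ
  set s := Real.sqrt (fsq (X₁ * X₁ᵀ - Z₁ * Z₁ᵀ)) with hs
  set t := Real.sqrt (fsq (X₂ * X₂ᵀ - Z₂ * Z₂ᵀ)) with ht
  have hs0 : 0 ≤ s := Real.sqrt_nonneg _
  have ht0 : 0 ≤ t := Real.sqrt_nonneg _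
  -- claim 1
  have c1 : α - s ≤ a := by
    rcases le_or_gt (α - s) 0 with h | h
    · linarith
    · have hX : ∀ w, α * (w ⬝ᵥ w) ≤ (X₁ᵀ *ᵥ w) ⬝ᵥ (X₁ᵀ *ᵥ w) := by
        refine lower_transpose le_rfl X₁ᵀ α (by linarith) ?_
        intro w
        rw [Matrix.transpose_transpose]
        exact lamMin_mul_le X₁ w
      refine le_lamMin hrs1 Z₁ _ (lower_transpose hrsk Z₁ _ h fun w => ?_)
      have h1 := (abs_le.mp (diff_quad X₁ Z₁ w)).2
      have h2 := hX w
      linarith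
  -- claim 2
  have c2 : b ≤ β + t := by
    have hX : ∀ w, (X₂ᵀ *ᵥ w) ⬝ᵥ (X₂ᵀ *ᵥ w) ≤ β * (w ⬝ᵥ w) := by
      refine upper_transpose X₂ᵀ β hβ0 ?_
      intro w
      rw [Matrix.transpose_transpose]
      exact le_lamMax_mul X₂ w
    refine lamMax_le hrs1 Z₂ _ (upper_transpose Z₂ _ (by linarith) fun w => ?_)
    have h1 := (abs_le.mp (diff_quad X₂ Z₂ w)).1
    have h2 := hX w
    linarith
  -- claim 3
  have c3 : a * b ≤ fsq (Z₁ * Z₂ᵀ) := by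
    refine le_trans (mul_le_mul_of_nonneg_left ?_ ha0) (fsq_cross Z₁ Z₂)
    exact lamMax_le hrs1 Z₂ _ (mulVec_fsq Z₂)
  have c3' : a * b ≤ fsq (Z₂ * Z₁ᵀ) := by
    have : fsq (Z₂ * Z₁ᵀ) = fsq (Z₁ * Z₂ᵀ) := by
      rw [← Matrix.transpose_transpose Z₂, ← Matrix.transpose_mul, Matrix.transpose_transpose]
      unfold fsq
      rw [Finset.sum_comm]
      rfl
    rw [this]; exact c3
  -- claim 4
  have c4 : μ - b ≤ a := by
    refine le_lamMin hrs1 Z₁ _ fun v => ?_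
    have h1 := lamMin_mul_le (Matrix.fromRows Z₁ Z₂) v
    have h2 := le_lamMax_mul Z₂ v
    rw [Matrix.fromRows_mulVec, sumElim_dotProduct_sumElim] at h1
    linarith
  -- the Frobenius norm
  have hF : fsq (Matrix.fromBlocks X₁ 0 0 X₂ * (Matrix.fromBlocks X₁ 0 0 X₂)ᵀ -
          Matrix.fromRows Z₁ Z₂ * (Matrix.fromRows Z₁ Z₂)ᵀ)
        = s ^ 2 + fsq (Z₁ * Z₂ᵀ) + fsq (Z₂ * Z₁ᵀ) + t ^ 2 := by
    have e : Matrix.fromBlocks X₁ 0 0 X₂ * (Matrix.fromBlocks X₁ 0 0 X₂)ᵀ -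
          Matrix.fromRows Z₁ Z₂ * (Matrix.fromRows Z₁ Z₂)ᵀ =
        Matrix.fromBlocks (X₁ * X₁ᵀ - Z₁ * Z₁ᵀ) (-(Z₁ * Z₂ᵀ)) (-(Z₂ * Z₁ᵀ))
          (X₂ * X₂ᵀ - Z₂ * Z₂ᵀ) := by
      rw [Matrix.fromBlocks_transpose, Matrix.fromBlocks_multiply, Matrix.transpose_fromRows,
        Matrix.fromRows_mul_fromCols]
      ext (i | i) (j | j) <;> simp
    have hneg : ∀ {p q : ℕ} (M : Matrix (Fin p) (Fin q) ℝ), fsq (-M) = fsq M := by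
      intro p q M; simp [fsq]
    rw [e, fsq_blocks, hneg, hneg, hs, ht, Real.sq_sqrt (fsq_nn _), Real.sq_sqrt (fsq_nn _)]
  rw [div_lt_div_iff₀ hZpos (by positivity)] at hρ
  have hfr : frobNorm (Matrix.fromBlocks X₁ 0 0 X₂ * (Matrix.fromBlocks X₁ 0 0 X₂)ᵀ -
          Matrix.fromRows Z₁ Z₂ * (Matrix.fromRows Z₁ Z₂)ᵀ) =
      Real.sqrt (s ^ 2 + fsq (Z₁ * Z₂ᵀ) + fsq (Z₂ * Z₁ᵀ) + t ^ 2) := by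
    rw [← hF]; rfl
  rw [hfr, ← Real.sqrt_mul' _ (by norm_num), one_mul, Real.sqrt_lt' hZpos] at hρ
  by_contra hlt
  push Not at hlt
  have h5 : (b - a) ^ 2 ≤ (s + t) ^ 2 := by
    apply pow_le_pow_left₀ <;> linarith
  have h6 : μ ^ 2 ≤ (a + b) ^ 2 := by
    apply pow_le_pow_left₀ <;> linarith
  nlinarith [sq_nonneg (s - t)]
end
end
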